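/- Let p > 3 be a prime with p ≡ 1 (mod 4) and n = (p−1)/2. Then for all real numbers x, y, z, w, the determinant of the n×n real matrix with (j,k) entry x + χ(j−k+1) + χ(j)·y + χ(k)·z + χ(jk)·w (0 ≤ j,k ≤ n−1) equals P·((w+1)x − yz) + L·(wx − (y+1)z) + L·Q·(w(1−x) + (y+1)(z+1)), where Q = B − A and P = pB − A. -/

import Mathlib

open Complex Matrix BigOperators Finset

/-- inverse weight -/
noncomputable def lagD {n : ℕ} (a : Fin n → ℂ) (l : Fin n) : ℂ :=
  ∏ m ∈ univ.erase l, (a l - a m)⁻¹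

theorem lag_eval {n : ℕ} (a : Fin n → ℂ) (ha : Function.Injective a) (s : ℂ)
    (hs : ∀ l, s ≠ a l) (f : Polynomial ℂ) (hf : f.degree < n) :
    f.eval s = ∑ l, (∏ m, (s - a m)) * lagD a l * (s - a l)⁻¹ * f.eval (a l) := by
  have h1 := Lagrange.eq_interpolate (s := univ) (v := a) (f := f) ha.injOn (by simpa using hf)
  have h2 := Lagrange.eval_interpolate_not_at_node (s := univ) (v := a)
    (fun i => f.eval (a i)) (x := s) (fun i _ => hs i)
  rw [← h1, Lagrange.eval_nodal, Finset.mul_sum] at h2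
  rw [h2]
  refine Finset.sum_congr rfl fun l _ => ?_
  simp only [lagD, Lagrange.nodalWeight]
  ring

/-- Lagrange matrix -/
noncomputable def lagM {n : ℕ} (a s : Fin n → ℂ) : Matrix (Fin n) (Fin n) ℂ :=
  Matrix.of fun i l => (∏ m, (s i - a m)) * lagD a l * (s i - a l)⁻¹

theorem lagM_mul {n : ℕ} (a s : Fin n → ℂ) (ha : Function.Injective a)
    (hs : ∀ i l, s i ≠ a l) : lagM a s * vandermonde a = vandermonde s := by
  ext i j
  have := lag_eval a ha (s i) (hs i) (Polynomial.X ^ (j : ℕ)) (by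
    rw [Polynomial.degree_X_pow]; exact_mod_cast j.2)
  simp only [Polynomial.eval_pow, Polynomial.eval_X] at this
  rw [Matrix.mul_apply]
  simp only [vandermonde_apply, lagM, of_apply]
  rw [this]

theorem prod_pair_mul {n : ℕ} (t : Fin n → ℂ) :
    ∏ i, ∏ j ∈ univ.erase i, (t i * t j) = (∏ i, t i) ^ (2 * (n - 1)) := by
  have h1 : ∀ i : Fin n, ∏ j ∈ univ.erase i, (t i * t j)
      = t i ^ (n-1) * ∏ j ∈ univ.erase i, t j := by
    intro i
    rw [Finset.prod_mul_distrib, Finset.prod_const, Finset.card_erase_of_mem (mem_univ _)]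
    simp
  simp_rw [h1]
  rw [Finset.prod_mul_distrib, two_mul, pow_add, Finset.prod_pow]
  congr 1
  rw [Finset.prod_comm' (s := univ) (t := fun i => univ.erase i) (t' := univ)
    (s' := fun i => univ.erase i) (by intro x y; simp [ne_comm])]
  rw [← Finset.prod_pow]
  refine Finset.prod_congr rfl fun i _ => ?_
  rw [Finset.prod_const, Finset.card_erase_of_mem (mem_univ _)]
  simp

theorem prod_Ioi_sq {n : ℕ} (f : Fin n → Fin n → ℂ) :
    ∏ i, ∏ j ∈ univ.erase i, f j i = ∏ i, ∏ j ∈ Ioi i, (f j i * f i j) := by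
  rw [Finset.prod_prod_Ioi_mul_eq_prod_prod_off_diag f]
  refine Finset.prod_congr rfl fun i _ => Finset.prod_congr ?_ fun _ _ => rfl
  ext; simp

theorem prod_Ioi_const {n : ℕ} (hn : Even n) :
    ∏ i : Fin n, ∏ _j ∈ Ioi i, (-1 : ℂ) = (-1) ^ (n / 2) := by
  have h : ∀ i : Fin n, ∏ _j ∈ Ioi i, (-1 : ℂ) = (-1) ^ (n - 1 - (i:ℕ)) := by
    intro i; simp
  simp_rw [h]
  rw [Finset.prod_pow_eq_pow_sum, Fin.sum_univ_eq_sum_range (fun i => n - 1 - i) n,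
    Finset.sum_range_reflect (fun i => i) n, Finset.sum_range_id]
  obtain ⟨m, rfl⟩ := hn
  have : (m + m) * (m + m - 1) / 2 = m * (m + m - 1) := by
    rw [← two_mul, mul_assoc, Nat.mul_div_cancel_left _ (by norm_num)]
  rw [this, ← two_mul, Nat.mul_div_cancel_left _ (by norm_num : 0 < 2), pow_mul]
  rcases Nat.eq_zero_or_pos m with rfl | hm
  · simp
  · rcases Nat.even_or_odd m with h | h
    · simp [h.neg_one_pow]
    · rw [h.neg_one_pow, Odd.neg_one_pow]
      exact ⟨m - 1, by omega⟩

theorem det_vand_sq {n : ℕ} (hn : Even n) (x : Fin n → ℂ) :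
    (vandermonde x).det ^ 2 = (-1) ^ (n / 2) * ∏ i, ∏ j ∈ univ.erase i, (x i - x j) := by
  rw [← prod_Ioi_const hn, prod_Ioi_sq (fun j i => x i - x j), det_vandermonde,
    ← Finset.prod_pow, ← Finset.prod_mul_distrib]
  refine Finset.prod_congr rfl fun i _ => ?_
  rw [← Finset.prod_pow, ← Finset.prod_mul_distrib]
  refine Finset.prod_congr rfl fun j _ => ?_
  ring

/-- Cauchy matrix -/
noncomputable def cauK {n : ℕ} (t : Fin n → ℂ) : Matrix (Fin n) (Fin n) ℂ :=
  Matrix.of fun i l => (1 + t i * t l)⁻¹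

theorem det_cauK {n : ℕ} (hn : Even n) (t : Fin n → ℂ) (h0 : ∀ i, t i ≠ 0)
    (hinj : Function.Injective t) (h1 : ∀ i l, 1 + t i * t l ≠ 0) :
    (cauK t).det * ∏ i, ∏ l, (1 + t i * t l) = ∏ i, ∏ l ∈ univ.erase i, (t i - t l) := by
  set s : Fin n → ℂ := fun i => - (t i)⁻¹ with hs
  have hst : ∀ i l, s i - t l = - (t i)⁻¹ * (1 + t i * t l) := by
    intro i l; simp only [hs]; field_simp [h0 i]; ring
  have hL := congrArg Matrix.det (lagM_mul t s hinj (by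
    intro i l h
    have := hst i l
    rw [h, sub_self] at this
    exact mul_ne_zero (neg_ne_zero.mpr (inv_ne_zero (h0 i))) (h1 i l) this.symm))
  have hV : (vandermonde t).det ≠ 0 := by rwa [det_vandermonde_ne_zero_iff]
  have hM : lagM t s = Matrix.diagonal (fun i => (∏ m, (s i - t m)) * (- t i)) * cauK t
      * Matrix.diagonal (lagD t) := by
    ext i l
    rw [Matrix.mul_diagonal, Matrix.diagonal_mul]
    simp only [lagM, of_apply, cauK, hst i l]
    rw [mul_inv, inv_neg, inv_inv]; ring
  have hsv : (vandermonde s).det * (∏ i, t i) ^ (n-1) = (vandermonde t).det := by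
    rw [det_vandermonde, det_vandermonde]
    have e1 : (∏ i, t i) ^ (n-1) = ∏ i, ∏ j ∈ Ioi i, (t j * t i) := by
      have : ∀ i : Fin n, ∏ j ∈ Ioi i, (t j * t i) = (∏ j ∈ Ioi i, t j) * t i ^ (n - 1 - (i:ℕ)) := by
        intro i; rw [Finset.prod_mul_distrib]; simp
      simp_rw [this]
      rw [Finset.prod_mul_distrib, Finset.prod_comm' (s := univ) (t := fun i => Ioi i) (t' := univ)
        (s' := fun i => Iio i) (by intro x y; simp), ← Finset.prod_mul_distrib, ← Finset.prod_pow]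
      refine Finset.prod_congr rfl fun i _ => ?_
      rw [Finset.prod_const, ← pow_add]
      congr 1
      have := i.2
      simp; omega
    rw [e1, ← Finset.prod_mul_distrib]
    refine Finset.prod_congr rfl fun i _ => ?_
    rw [← Finset.prod_mul_distrib]
    refine Finset.prod_congr rfl fun j _ => ?_
    simp only [hs]; field_simp [h0 i, h0 j]; ring
  rw [hM] at hL
  simp only [det_mul, det_diagonal] at hL
  have hτ : ∏ i, t i ≠ 0 := Finset.prod_ne_zero_iff.mpr fun i _ => h0 i
  have hP : (∏ i, ((∏ m, (s i - t m)) * (- t i))) * (∏ i, t i)^(n-1)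
      = ∏ i, ∏ l, (1 + t i * t l) := by
    have e2 : ∏ i, ∏ l, (1 + t i * t l) = ∏ i, ((-1) * ∏ l, (1 + t i * t l)) := by
      rw [Finset.prod_mul_distrib]
      simp [hn.neg_one_pow]
    rw [e2, ← Finset.prod_pow, ← Finset.prod_mul_distrib]
    refine Finset.prod_congr rfl fun i _ => ?_
    simp_rw [hst i]
    rw [Finset.prod_mul_distrib]
    simp only [prod_const, card_univ, Fintype.card_fin]
    rw [hn.neg_pow, inv_pow]
    have hn1 : n = (n - 1) + 1 := by have := i.2; omega
    have h3 : t i ^ n = t i ^ (n-1) * t i := by conv_lhs => rw [hn1, pow_succ]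
    have h4 := pow_ne_zero (n-1) (h0 i)
    rw [h3]
    field_simp [h0 i]
  have hD : (∏ l, lagD t l) * ∏ i, ∏ l ∈ univ.erase i, (t i - t l) = 1 := by
    rw [← Finset.prod_mul_distrib]
    refine Finset.prod_eq_one fun i _ => ?_
    rw [lagD, ← Finset.prod_mul_distrib]
    refine Finset.prod_eq_one fun l hl => ?_
    rw [inv_mul_cancel₀]
    rw [sub_ne_zero]; exact fun h => (Finset.ne_of_mem_erase hl) (hinj h).symm
  have h5 : (∏ i, ∏ l, (1 + t i * t l)) * (cauK t).det * (∏ l, lagD t l) = 1 := by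
    apply mul_right_cancel₀ hV
    rw [one_mul]
    conv_rhs => rw [← hsv, ← hL]
    rw [← hP]; ring
  calc _ = ((∏ i, ∏ l, (1 + t i * t l)) * (cauK t).det * (∏ l, lagD t l))
      * ∏ i, ∏ l ∈ univ.erase i, (t i - t l) := by
        rw [mul_assoc _ (∏ l, lagD t l), hD]; ring
    _ = _ := by rw [h5, one_mul]

theorem monic_sub_degree_lt {n : ℕ} (P Q : Polynomial ℂ) (hP : P.Monic) (hQ : Q.Monic)
    (dP : P.natDegree = n + 1) (dQ : Q.natDegree = n + 1) (h : P.nextCoeff = Q.nextCoeff) :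
    (P - Q).degree < n := by
  rw [Polynomial.degree_lt_iff_coeff_zero]
  intro m hm
  rw [Polynomial.coeff_sub, sub_eq_zero]
  rcases Nat.lt_trichotomy m (n+1) with h1 | h1 | h1
  · have : m = n := by omega
    subst this
    rw [Polynomial.nextCoeff_of_natDegree_pos (by omega),
      Polynomial.nextCoeff_of_natDegree_pos (by omega), dP, dQ] at h
    simpa using h
  · subst h1
    have a := hP.coeff_natDegree
    have b := hQ.coeff_natDegree
    rw [dP] at a; rw [dQ] at b; rw [a, b]
  · rw [Polynomial.coeff_eq_zero_of_natDegree_lt (by omega),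
      Polynomial.coeff_eq_zero_of_natDegree_lt (by omega)]

theorem exists_f {n : ℕ} (hn : Even n) (t : Fin n → ℂ) (h0 : ∀ i, t i ≠ 0)
    (hinj : Function.Injective t) (h1 : ∀ i l, 1 + t i * t l ≠ 0)
    (hp : ∀ i, 1 + t i ≠ 0) (hm : ∀ i, 1 - t i ≠ 0) (g τ : ℂ) (hg : g = ∑ i, (t i + (t i)⁻¹))
    (hτ : τ = ∏ i, t i) :
    ∃ f : Fin n → ℂ, (∀ l, ∑ i, f i * (1 + t i * t l)⁻¹ = t l) ∧
      (∑ i, f i * (1 + t i)⁻¹) * ∏ i, (1 + t i) = ∏ i, (1 + t i) - τ * (1 + g) * ∏ i, (1 - t i) ∧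
      (∑ i, f i * (1 - t i)⁻¹) * ∏ i, (1 - t i)
        = - ∏ i, (1 - t i) - τ * (g - 1) * ∏ i, (1 + t i) := by
  have hτ0 : τ ≠ 0 := by rw [hτ]; exact Finset.prod_ne_zero_iff.mpr fun i _ => h0 i
  set a : Fin n → ℂ := fun i => - (t i)⁻¹ with ha
  have ainj : Function.Injective a := by
    intro i j h; simp only [ha, neg_inj, _root_.inv_inj] at h; exact hinj h
  set P1 : Polynomial ℂ := Polynomial.X * ∏ i, (Polynomial.X - Polynomial.C (a i)) with hP1
  set P2 : Polynomial ℂ := (Polynomial.X + Polynomial.C g) * ∏ i, (Polynomial.X - Polynomial.C (t i)) with hP2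
  have m1 : (∏ i, (Polynomial.X - Polynomial.C (a i))).Monic := Polynomial.monic_prod_X_sub_C _ _
  have m2 : (∏ i, (Polynomial.X - Polynomial.C (t i))).Monic := Polynomial.monic_prod_X_sub_C _ _
  have hdeg : (P1 - P2).degree < n := by
    apply monic_sub_degree_lt
    · exact Polynomial.monic_X.mul m1
    · exact (Polynomial.monic_X_add_C g).mul m2
    · rw [hP1, Polynomial.monic_X.natDegree_mul m1, Polynomial.natDegree_X,
        Polynomial.natDegree_finsetProd_X_sub_C_eq_card]; simp [add_comm]
    · rw [hP2, (Polynomial.monic_X_add_C g).natDegree_mul m2, Polynomial.natDegree_X_add_C,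
        Polynomial.natDegree_finsetProd_X_sub_C_eq_card]; simp [add_comm]
    · rw [hP1, hP2, Polynomial.monic_X.nextCoeff_mul m1,
        (Polynomial.monic_X_add_C g).nextCoeff_mul m2, Polynomial.prod_X_sub_C_nextCoeff,
        Polynomial.prod_X_sub_C_nextCoeff, Polynomial.nextCoeff_X_add_C, hg, Finset.sum_add_distrib]
      have : (Polynomial.X : Polynomial ℂ).nextCoeff = 0 := by
        simpa using Polynomial.nextCoeff_X_add_C (0:ℂ)
      rw [this]; simp [ha]
  have key : ∀ s : ℂ, (∀ i, 1 + t i * s ≠ 0) →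
      (∑ i, (lagD a i * t i * (P1 - P2).eval (a i)) * (1 + t i * s)⁻¹) * ∏ i, (1 + t i * s)
        = s * ∏ i, (1 + t i * s) - τ * (s + g) * ∏ i, (s - t i) := by
    intro s hs
    have hsa : ∀ i, s - a i = (t i)⁻¹ * (1 + t i * s) := by
      intro i; simp only [ha]; field_simp [h0 i]; ring
    have e := lag_eval a ainj s (by
      intro l h
      have := hsa l
      rw [← h, sub_self] at this
      exact mul_ne_zero (inv_ne_zero (h0 l)) (hs l) this.symm) _ hdeg
    have hprod : ∏ i, (s - a i) = τ⁻¹ * ∏ i, (1 + t i * s) := by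
      simp_rw [hsa]; rw [Finset.prod_mul_distrib, hτ, Finset.prod_inv_distrib]
    have hl : (P1 - P2).eval s = s * ∏ i, (s - a i) - (s + g) * ∏ i, (s - t i) := by
      simp [hP1, hP2, Polynomial.eval_prod]
    rw [hl] at e
    have e' : ∑ l, (∏ m, (s - a m)) * lagD a l * (s - a l)⁻¹ * (P1 - P2).eval (a l)
       = τ⁻¹ * ((∑ i, (lagD a i * t i * (P1 - P2).eval (a i)) * (1 + t i * s)⁻¹) * ∏ i, (1 + t i * s)) := by
      rw [hprod, Finset.sum_mul, Finset.mul_sum]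
      refine Finset.sum_congr rfl fun i _ => ?_
      rw [hsa, mul_inv, inv_inv]; ring
    rw [e', hprod] at e
    have := congrArg (fun z => τ * z) e
    rw [← mul_assoc τ τ⁻¹, mul_inv_cancel₀ hτ0, one_mul] at this
    rw [← this]; field_simp
  refine ⟨fun i => lagD a i * t i * (P1 - P2).eval (a i), ?_, ?_, ?_⟩
  · intro l
    have := key (t l) (fun i => h1 i l)
    rw [Finset.prod_eq_zero (f := fun i => t l - t i) (mem_univ l) (sub_self _), mul_zero, sub_zero] at this
    exact mul_right_cancel₀ (Finset.prod_ne_zero_iff.mpr fun i _ => h1 i l) this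
  · have := key 1 (by simpa using hp)
    simpa using this
  · have := key (-1) (by intro i; have := hm i; rwa [mul_neg_one, ← sub_eq_add_neg])
    have e3 : ∏ i, ((-1 : ℂ) - t i) = ∏ i, (1 + t i) := by
      have : ∀ i, (-1 : ℂ) - t i = (-1) * (1 + t i) := by intro i; ring
      simp_rw [this]; rw [Finset.prod_mul_distrib]; simp [hn.neg_one_pow]
    rw [e3] at this
    simp only [mul_neg_one, ← sub_eq_add_neg] at this
    rw [this]; ring

theorem G_entry {n : ℕ} (t e : Fin n → ℂ) (κ : ℂ) (h0 : ∀ i, t i ≠ 0)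
    (hxx : ∀ i l, 1 - t i ^ 2 * t l ^ 2 ≠ 0) (h2 : ∀ i, t i ^ 2 - 1 ≠ 0)
    (hK : ∀ i, ∏ m, ((t i ^ 2)⁻¹ - t m ^ 2)
      = κ * e i * lagD (fun i => t i ^ 2) i / (t i * (t i ^ 2 - 1))) (i l : Fin n) :
    lagM (fun i => t i ^ 2) (fun i => (t i ^ 2)⁻¹) i l
      = κ * e i * lagD (fun i => t i ^ 2) i * lagD (fun i => t i ^ 2) l * t i /
        ((t i ^ 2 - 1) * (1 - t i ^ 2 * t l ^ 2)) := by
  simp only [lagM, of_apply]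
  rw [hK]
  have e1 : (t i ^ 2)⁻¹ - t l ^ 2 = (t i ^ 2)⁻¹ * (1 - t i ^ 2 * t l ^ 2) := by
    field_simp [h0 i]
  rw [e1]
  have := h0 i; have := hxx i l; have := h2 i
  field_simp

theorem detB {n : ℕ} (hn : Even n) (t e : Fin n → ℂ) (κ L g ξ : ℂ) (χ : ℤ → ℂ)
    (h0 : ∀ i, t i ≠ 0) (hx : Function.Injective (fun i => t i ^ 2))
    (hxx : ∀ i l, 1 - t i ^ 2 * t l ^ 2 ≠ 0) (h2 : ∀ i, t i ^ 2 - 1 ≠ 0)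
    (he : ∀ i, e i ^ 2 = 1) (hL : L ^ 2 = 1)
    (hK : ∀ i, ∏ m, ((t i ^ 2)⁻¹ - t m ^ 2)
      = κ * e i * lagD (fun i => t i ^ 2) i / (t i * (t i ^ 2 - 1)))
    (hκ : (∏ i, (1 - t i ^ 2)) ^ 2 = κ)
    (hχ : ∀ m : ℤ, g * χ m = L * ∑ i, e i * ((t i ^ 2) ^ m + (t i ^ 2) ^ (-m))) :
    g ^ n * (Matrix.of fun j k : Fin n => χ ((j : ℤ) - k + 1) + ξ).det
      = (vandermonde (fun i => t i ^ 2)).det ^ 2 * κ ^ n * (∏ i, lagD (fun i => t i ^ 2) i) ^ 2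
        * (∏ i, (t i * (t i ^ 2 - 1))⁻¹)
        * (cauK t + vecMulVec (fun i => (t i - ξ * g * L) / (1 - t i ^ 2)) t).det := by
  set x : Fin n → ℂ := fun i => t i ^ 2 with hxdef
  have hx0 : ∀ i, x i ≠ 0 := fun i => pow_ne_zero 2 (h0 i)
  set V := vandermonde x with hV
  set V' := vandermonde (fun i => (x i)⁻¹) with hV'
  set G := lagM x (fun i => (x i)⁻¹) with hG
  have hGV : G * V = V' := by
    apply lagM_mul _ _ hx
    intro i l h
    apply hxx i l
    have : x i * x l = 1 := by rw [← h]; exact mul_inv_cancel₀ (hx0 i)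
    simp only [hxdef] at this; rw [this, sub_self]
  set α : Fin n → ℂ := fun l => (∏ m, (1 - x m)) * lagD x l * (1 - x l)⁻¹ with hα
  have hαV : α ᵥ* V = fun _ => 1 := by
    ext j
    have := lag_eval x hx 1 (by
      intro l h; apply h2 l; simp only [hxdef] at h; rw [← h, sub_self]) (Polynomial.X ^ (j : ℕ)) (by
      rw [Polynomial.degree_X_pow]; exact_mod_cast j.2)
    simp only [Polynomial.eval_pow, Polynomial.eval_X, one_pow] at this
    simp only [Matrix.vecMul, dotProduct, hα, hV, vandermonde_apply]
    exact this.symm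
  set U := Matrix.diagonal (fun i => L * e i * x i) * G + Gᵀ * Matrix.diagonal (fun i => L * e i * (x i)⁻¹)
    + vecMulVec ((g * ξ) • α) α with hU
  have hMat : g • (Matrix.of fun j k : Fin n => χ ((j : ℤ) - k + 1) + ξ) = Vᵀ * U * V := by
    have e1 : Vᵀ * U * V = Vᵀ * (Matrix.diagonal (fun i => L * e i * x i) * V')
        + V'ᵀ * (Matrix.diagonal (fun i => L * e i * (x i)⁻¹) * V)
        + vecMulVec ((g * ξ) • (α ᵥ* V)) (α ᵥ* V) := by
      rw [← hGV, hU, transpose_mul]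
      simp only [Matrix.mul_add, Matrix.add_mul, Matrix.mul_assoc]
      congr 1
      rw [← Matrix.mul_assoc, mul_vecMulVec, vecMulVec_mul, mulVec_transpose, smul_vecMul]
    rw [e1, hαV]
    ext j k
    rw [Matrix.add_apply, Matrix.add_apply, Matrix.mul_apply, Matrix.mul_apply]
    simp only [Matrix.smul_apply, of_apply, smul_eq_mul, mul_add, hχ,
      transpose_apply, Matrix.diagonal_mul, hV, hV', vandermonde_apply, vecMulVec_apply, Pi.smul_apply]
    rw [← Finset.sum_add_distrib, Finset.mul_sum]
    congr 1
    · refine Finset.sum_congr rfl fun i _ => ?_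
      have hxi := hx0 i
      have a1 : (t i ^ 2) ^ ((j:ℤ) - k + 1) = x i ^ (j:ℕ) * x i * (x i)⁻¹ ^ (k:ℕ) := by
        change x i ^ _ = _
        rw [zpow_add₀ hxi, zpow_sub₀ hxi, zpow_one, zpow_natCast, zpow_natCast, inv_pow]
        field_simp
      have a2 : (t i ^ 2) ^ (-((j:ℤ) - k + 1)) = (x i)⁻¹ ^ (j:ℕ) * (x i)⁻¹ * (x i) ^ (k:ℕ) := by
        change x i ^ _ = _
        rw [_root_.zpow_neg, zpow_add₀ hxi, zpow_sub₀ hxi, zpow_one, zpow_natCast, zpow_natCast, inv_pow]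
        field_simp
      rw [a1, a2]; ring
    · ring
  have hUe : U = κ • (Matrix.diagonal (fun i => L * lagD x i) * (cauK t + vecMulVec (fun i => (t i - ξ * g * L) / (1 - t i ^ 2)) t)
      * Matrix.diagonal (fun l => lagD x l * (t l * (t l ^ 2 - 1))⁻¹)) := by
    ext i l
    rw [hU]
    simp only [Matrix.smul_apply, smul_eq_mul, Matrix.add_apply, Matrix.mul_diagonal, Matrix.diagonal_mul,
      transpose_apply, vecMulVec_apply, Pi.smul_apply, cauK, of_apply]
    rw [hG, G_entry t e κ h0 hxx h2 hK i l, G_entry t e κ h0 hxx h2 hK l i]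
    have q1 := h0 i; have q2 := h0 l; have q3 := hxx i l; have q4 := h2 i; have q5 := h2 l
    have q6 : 1 + t i * t l ≠ 0 := by
      intro h; apply q3; linear_combination (1 - t i * t l) * h
    have q7 : 1 - t i * t l ≠ 0 := by
      intro h; apply q3; linear_combination (1 + t i * t l) * h
    have q8 : 1 - t i ^ 2 ≠ 0 := by
      intro h; apply q4; linear_combination -h
    have q9 : 1 - t l ^ 2 ≠ 0 := by
      intro h; apply q5; linear_combination -h
    have q10 : 1 - t l ^ 2 * t i ^ 2 ≠ 0 := by
      intro h; apply q3; linear_combination h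
    have p1 : g * ξ * α i * α l = g * ξ * κ * L ^ 2 * lagD x i * lagD x l / ((1 - t i ^ 2) * (1 - t l ^ 2)) := by
      simp only [hα, hxdef]; rw [← hκ, hL]; field_simp
    rw [p1]
    have p2 : L * e i * x i * (κ * e i * lagD x i * lagD x l * t i / ((t i ^ 2 - 1) * (1 - t i ^ 2 * t l ^ 2)))
       = L * κ * lagD x i * lagD x l * (t i ^ 3 / ((t i ^ 2 - 1) * (1 - t i ^ 2 * t l ^ 2))) := by
      have := he i
      calc _ = L * (e i ^ 2) * x i * (κ * lagD x i * lagD x l * t i / ((t i ^ 2 - 1) * (1 - t i ^ 2 * t l ^ 2))) := by ring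
        _ = _ := by rw [this]; simp only [hxdef]; ring
    have p3 : κ * e l * lagD x l * lagD x i * t l / ((t l ^ 2 - 1) * (1 - t l ^ 2 * t i ^ 2)) * (L * e l * (x l)⁻¹)
       = L * κ * lagD x i * lagD x l * (1 / (t l * (t l ^ 2 - 1) * (1 - t i ^ 2 * t l ^ 2))) := by
      have := he l
      calc _ = L * (e l ^ 2) * (x l)⁻¹ * (κ * lagD x i * lagD x l * t l / ((t l ^ 2 - 1) * (1 - t l ^ 2 * t i ^ 2))) := by ring
        _ = _ := by rw [this]; simp only [hxdef]; rw [mul_comm (t l ^ 2) (t i ^ 2)]; field_simp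
    rw [p2, p3]
    have p4 : t i ^ 3 / ((t i ^ 2 - 1) * (1 - t i ^ 2 * t l ^ 2)) + 1 / (t l * (t l ^ 2 - 1) * (1 - t i ^ 2 * t l ^ 2))
       = ((1 + t i * t l)⁻¹ + t i / (1 - t i ^ 2) * t l) * (t l * (t l ^ 2 - 1))⁻¹ := by
      have r1 : 1 - t i ^ 2 * t l ^ 2 = (1 - t i * t l) * (1 + t i * t l) := by ring
      have r2 : t i ^ 2 - 1 = - (1 - t i ^ 2) := by ring
      rw [r1, r2]
      field_simp
      ring
    have p5 : (1 - t l ^ 2) = - (t l ^ 2 - 1) := by ring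
    rw [← mul_add, p4, p5]
    field_simp
    ring
  have hdet := congrArg Matrix.det hMat
  rw [det_smul, Fintype.card_fin, det_mul, det_mul, det_transpose, hUe, det_smul, Fintype.card_fin,
    det_mul, det_mul, det_diagonal, det_diagonal, Finset.prod_mul_distrib, Finset.prod_mul_distrib] at hdet
  rw [hdet]
  have : ∏ _i : Fin n, L = 1 := by
    simp only [prod_const, card_univ, Fintype.card_fin]
    obtain ⟨m, rfl⟩ := hn
    rw [← two_mul, pow_mul, hL, one_pow]
  rw [this]; ring

theorem det_upper_one {n : ℕ} :
    (Matrix.of fun a j : Fin n => if a ≤ j then (1 : ℂ) else 0).det = 1 := by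
  rw [det_of_isUpperTriangular]
  · simp
  · intro i j h
    simp only [id] at h
    simp [not_le.mpr h]

theorem detA {n : ℕ} (hn : Even n) (t e : Fin n → ℂ) (κ L g : ℂ) (χ : ℤ → ℂ)
    (h0 : ∀ i, t i ≠ 0) (hx : Function.Injective (fun i => t i ^ 2))
    (hxx : ∀ i l, 1 - t i ^ 2 * t l ^ 2 ≠ 0) (h2 : ∀ i, t i ^ 2 - 1 ≠ 0)
    (he : ∀ i, e i ^ 2 = 1) (hL : L ^ 2 = 1)
    (hK : ∀ i, ∏ m, ((t i ^ 2)⁻¹ - t m ^ 2)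
      = κ * e i * lagD (fun i => t i ^ 2) i / (t i * (t i ^ 2 - 1)))
    (hχ : ∀ m : ℤ, g * χ m = L * ∑ i, e i * ((t i ^ 2) ^ m + (t i ^ 2) ^ (-m))) :
    g ^ n * (Matrix.of fun j k : Fin n => χ ((j : ℤ) - k + 1) - χ k).det
      = (vandermonde (fun i => t i ^ 2)).det ^ 2 * κ ^ n * (∏ i, lagD (fun i => t i ^ 2) i) ^ 2
        * (∏ i, (t i)⁻¹) * (cauK t).det := by
  set x : Fin n → ℂ := fun i => t i ^ 2 with hxdef
  have hx0 : ∀ i, x i ≠ 0 := fun i => pow_ne_zero 2 (h0 i)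
  set V := vandermonde x with hV
  set V' := vandermonde (fun i => (x i)⁻¹) with hV'
  set G := lagM x (fun i => (x i)⁻¹) with hG
  have hGV : G * V = V' := by
    apply lagM_mul _ _ hx
    intro i l h
    apply hxx i l
    have : x i * x l = 1 := by rw [← h]; exact mul_inv_cancel₀ (hx0 i)
    simp only [hxdef] at this; rw [this, sub_self]
  set T : Matrix (Fin n) (Fin n) ℂ := Matrix.of fun a j : Fin n => if a ≤ j then (1 : ℂ) else 0 with hT
  have hgeo : ∀ (y : Fin n → ℂ) (i j : Fin n), (y i - 1) * (vandermonde y * T) i j = y i ^ ((j : ℕ) + 1) - 1 := by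
    intro y i j
    rw [← mul_geom_sum, Matrix.mul_apply]
    congr 1
    simp only [vandermonde_apply, hT, of_apply, mul_ite, mul_one, mul_zero]
    simp only [Fin.le_def]
    rw [Fin.sum_univ_eq_sum_range (fun a => if a ≤ (j:ℕ) then y i ^ a else 0) n, ← Finset.sum_filter]
    refine Finset.sum_congr ?_ fun _ _ => rfl
    ext a; have := j.2; simp only [mem_range, mem_filter]; omega
  set U := Matrix.diagonal (fun i => L * e i * (x i - 1)) * G
    + Gᵀ * Matrix.diagonal (fun i => L * e i * ((x i)⁻¹ - 1)) with hU
  have hMat : g • (Matrix.of fun j k : Fin n => χ ((j : ℤ) - k + 1) - χ k) = Tᵀ * (Vᵀ * U * V) := by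
    have e1 : Tᵀ * (Vᵀ * U * V) = (V * T)ᵀ * (Matrix.diagonal (fun i => L * e i * (x i - 1)) * V')
        + (V' * T)ᵀ * (Matrix.diagonal (fun i => L * e i * ((x i)⁻¹ - 1)) * V) := by
      rw [← hGV, hU, transpose_mul, transpose_mul, transpose_mul]
      simp only [Matrix.mul_add, Matrix.add_mul, Matrix.mul_assoc]
    rw [e1]
    ext j k
    rw [Matrix.add_apply, Matrix.mul_apply, Matrix.mul_apply]
    simp only [Matrix.smul_apply, of_apply, smul_eq_mul, mul_sub, hχ,
      transpose_apply, Matrix.diagonal_mul]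
    rw [← Finset.sum_add_distrib, Finset.mul_sum, Finset.mul_sum, ← Finset.sum_sub_distrib]
    refine Finset.sum_congr rfl fun i _ => ?_
    have hxi := hx0 i
    have a1 : (t i ^ 2) ^ ((j:ℤ) - k + 1) = x i ^ ((j:ℕ) + 1) * (x i)⁻¹ ^ (k:ℕ) := by
      change x i ^ _ = _
      rw [zpow_add₀ hxi, zpow_sub₀ hxi, zpow_one, zpow_natCast, zpow_natCast, inv_pow, pow_succ]
      field_simp
    have a2 : (t i ^ 2) ^ (-((j:ℤ) - k + 1)) = (x i)⁻¹ ^ ((j:ℕ)+1) * (x i) ^ (k:ℕ) := by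
      change x i ^ _ = _
      rw [_root_.zpow_neg, zpow_add₀ hxi, zpow_sub₀ hxi, zpow_one, zpow_natCast, zpow_natCast, inv_pow, pow_succ]
      field_simp
    have a3 : (t i ^ 2) ^ (k:ℤ) = x i ^ (k:ℕ) := zpow_natCast _ _
    have a4 : (t i ^ 2) ^ (-(k:ℤ)) = (x i)⁻¹ ^ (k:ℕ) := by
      rw [_root_.zpow_neg, zpow_natCast, inv_pow]
    have b1 := hgeo x i j
    have b2 := hgeo (fun i => (x i)⁻¹) i j
    rw [a1, a2, a3, a4]
    have c1 : V' i k = (x i)⁻¹ ^ (k:ℕ) := rfl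
    have c2 : V i k = x i ^ (k:ℕ) := rfl
    rw [c1, c2]
    calc _ = L * e i * ((x i ^ ((j:ℕ)+1) - 1) * (x i)⁻¹ ^ (k:ℕ) + ((x i)⁻¹ ^ ((j:ℕ)+1) - 1) * x i ^ (k:ℕ)) := by ring
      _ = _ := by rw [← b1, ← b2]; ring
  have hUe : U = κ • (Matrix.diagonal (fun i => - L * lagD x i) * cauK t
      * Matrix.diagonal (fun l => lagD x l * (t l)⁻¹)) := by
    ext i l
    rw [hU]
    simp only [Matrix.smul_apply, smul_eq_mul, Matrix.add_apply, Matrix.mul_diagonal, Matrix.diagonal_mul,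
      transpose_apply, cauK, of_apply]
    rw [hG, G_entry t e κ h0 hxx h2 hK i l, G_entry t e κ h0 hxx h2 hK l i]
    have q1 := h0 i; have q2 := h0 l; have q3 := hxx i l; have q4 := h2 i; have q5 := h2 l
    have q6 : 1 + t i * t l ≠ 0 := by
      intro h; apply q3; linear_combination (1 - t i * t l) * h
    have q7 : 1 - t i * t l ≠ 0 := by
      intro h; apply q3; linear_combination (1 + t i * t l) * h
    have p2 : L * e i * (x i - 1) * (κ * e i * lagD x i * lagD x l * t i / ((t i ^ 2 - 1) * (1 - t i ^ 2 * t l ^ 2)))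
       = L * κ * lagD x i * lagD x l * (t i / (1 - t i ^ 2 * t l ^ 2)) := by
      have := he i
      calc _ = L * (e i ^ 2) * (x i - 1) * (κ * lagD x i * lagD x l * t i / ((t i ^ 2 - 1) * (1 - t i ^ 2 * t l ^ 2))) := by ring
        _ = _ := by rw [this]; simp only [hxdef]; field_simp
    have p3 : κ * e l * lagD x l * lagD x i * t l / ((t l ^ 2 - 1) * (1 - t l ^ 2 * t i ^ 2)) * (L * e l * ((x l)⁻¹ - 1))
       = L * κ * lagD x i * lagD x l * (- (t l)⁻¹ / (1 - t i ^ 2 * t l ^ 2)) := by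
      have := he l
      have h3 : (x l)⁻¹ - 1 = - (x l)⁻¹ * (t l ^ 2 - 1) := by
        simp only [hxdef]; field_simp; ring
      calc _ = L * (e l ^ 2) * ((x l)⁻¹ - 1) * (κ * lagD x i * lagD x l * t l / ((t l ^ 2 - 1) * (1 - t l ^ 2 * t i ^ 2))) := by ring
        _ = _ := by
          rw [this, h3]; simp only [hxdef]; rw [mul_comm (t l ^ 2) (t i ^ 2)]; field_simp
    rw [p2, p3]
    have p4 : t i / (1 - t i ^ 2 * t l ^ 2) + - (t l)⁻¹ / (1 - t i ^ 2 * t l ^ 2)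
       = - (1 + t i * t l)⁻¹ * (t l)⁻¹ := by
      have r1 : 1 - t i ^ 2 * t l ^ 2 = (1 - t i * t l) * (1 + t i * t l) := by ring
      rw [r1]
      field_simp
      ring
    rw [← mul_add, p4]
    ring
  have hdet := congrArg Matrix.det hMat
  rw [det_smul, Fintype.card_fin, det_mul, det_mul, det_mul, det_transpose, det_transpose, hUe, det_smul, Fintype.card_fin,
    det_mul, det_mul, det_diagonal, det_diagonal, Finset.prod_mul_distrib, Finset.prod_mul_distrib,
    hT, det_upper_one] at hdet
  rw [hdet]
  have : ∏ _i : Fin n, -L = 1 := by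
    simp only [prod_const, card_univ, Fintype.card_fin]
    obtain ⟨m, rfl⟩ := hn
    rw [← two_mul, pow_mul, neg_sq, hL, one_pow]
  rw [this]; ring

theorem detB' {n : ℕ} (hn : Even n) (t e : Fin n → ℂ) (κ L g ξ τ : ℂ) (χ : ℤ → ℂ)
    (h0 : ∀ i, t i ≠ 0) (hx : Function.Injective (fun i => t i ^ 2))
    (hxx : ∀ i l, 1 - t i ^ 2 * t l ^ 2 ≠ 0) (h2 : ∀ i, t i ^ 2 - 1 ≠ 0)
    (he : ∀ i, e i ^ 2 = 1) (hL : L ^ 2 = 1)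
    (hK : ∀ i, ∏ m, ((t i ^ 2)⁻¹ - t m ^ 2)
      = κ * e i * lagD (fun i => t i ^ 2) i / (t i * (t i ^ 2 - 1)))
    (hκ : (∏ i, (1 - t i ^ 2)) ^ 2 = κ)
    (hχ : ∀ m : ℤ, g * χ m = L * ∑ i, e i * ((t i ^ 2) ^ m + (t i ^ 2) ^ (-m)))
    (hg0 : g ≠ 0) (hg : g = ∑ i, (t i + (t i)⁻¹)) (hτ : τ = ∏ i, t i) :
    2 * κ * (Matrix.of fun j k : Fin n => χ ((j : ℤ) - k + 1) + ξ).det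
      = (Matrix.of fun j k : Fin n => χ ((j : ℤ) - k + 1) - χ k).det * τ *
        ((1 + ξ * g * L) * (1 + g) * (∏ i, (1 - t i)) ^ 2
          + (1 - ξ * g * L) * (1 - g) * (∏ i, (1 + t i)) ^ 2) := by
  have hA := detA hn t e κ L g χ h0 hx hxx h2 he hL hK hχ
  have hB := detB hn t e κ L g ξ χ h0 hx hxx h2 he hL hK hκ hχ
  have q6 : ∀ i l, 1 + t i * t l ≠ 0 := by
    intro i l h; apply hxx i l; linear_combination (1 - t i * t l) * h
  have hp : ∀ i, 1 + t i ≠ 0 := by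
    intro i h; apply h2 i; linear_combination (t i - 1) * h
  have hm : ∀ i, 1 - t i ≠ 0 := by
    intro i h; apply h2 i; linear_combination (-t i - 1) * h
  have hinj : Function.Injective t := by
    intro i j h; apply hx; simp [h]
  obtain ⟨f, hf, hf1, hf2⟩ := exists_f hn t h0 hinj q6 hp hm g τ hg hτ
  set u : Fin n → ℂ := fun i => (t i - ξ * g * L) / (1 - t i ^ 2) with hu
  have hKd : (cauK t + vecMulVec u t).det = (1 + f ⬝ᵥ u) * (cauK t).det := by
    have : cauK t + vecMulVec u t = (1 + vecMulVec u f) * cauK t := by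
      rw [Matrix.add_mul, one_mul, vecMulVec_mul]
      congr 2
      ext l
      simp only [vecMul, dotProduct, cauK, of_apply]
      exact (hf l).symm
    rw [this, det_mul]
    congr 1
    rw [vecMulVec_eq Unit, det_one_add_replicateCol_mul_replicateRow]
  have hfu : 2 * (f ⬝ᵥ u) = (1 - ξ * g * L) * (∑ i, f i * (1 - t i)⁻¹)
      - (1 + ξ * g * L) * (∑ i, f i * (1 + t i)⁻¹) := by
    rw [dotProduct, Finset.mul_sum, Finset.mul_sum, Finset.mul_sum, ← Finset.sum_sub_distrib]
    refine Finset.sum_congr rfl fun i _ => ?_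
    have a := hp i; have b := hm i
    simp only [hu]
    have : 1 - t i ^ 2 = (1 - t i) * (1 + t i) := by ring
    rw [this]; field_simp; ring
  set Pp := ∏ i, (1 + t i) with hPp
  set Pm := ∏ i, (1 - t i) with hPm
  have hPp0 : Pp ≠ 0 := Finset.prod_ne_zero_iff.mpr fun i _ => hp i
  have hPm0 : Pm ≠ 0 := Finset.prod_ne_zero_iff.mpr fun i _ => hm i
  have hG1 : ∏ i, (1 - t i ^ 2) = Pp * Pm := by
    rw [hPp, hPm, ← Finset.prod_mul_distrib]
    exact Finset.prod_congr rfl fun i _ => by ring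
  have hG2 : ∏ i, (t i * (t i ^ 2 - 1))⁻¹ = (∏ i, (t i)⁻¹) * (Pp * Pm)⁻¹ := by
    rw [← hG1, ← Finset.prod_inv_distrib, ← Finset.prod_mul_distrib]
    have e2 : ∏ i, ((t i)⁻¹ * (1 - t i ^ 2)⁻¹) = ∏ i, ((-1) * ((t i)⁻¹ * (1 - t i ^ 2)⁻¹)) := by
      rw [Finset.prod_mul_distrib (f := fun _ => (-1:ℂ))]
      simp [hn.neg_one_pow]
    rw [e2]
    refine Finset.prod_congr rfl fun i _ => ?_
    have : t i ^ 2 - 1 = - (1 - t i ^ 2) := by ring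
    rw [this, mul_inv, inv_neg]; ring
  rw [hKd, hG2] at hB
  have hB' : (Matrix.of fun j k : Fin n => χ ((j : ℤ) - k + 1) + ξ).det
      = (Matrix.of fun j k : Fin n => χ ((j : ℤ) - k + 1) - χ k).det * (Pp * Pm)⁻¹ * (1 + f ⬝ᵥ u) := by
    apply mul_left_cancel₀ (pow_ne_zero n hg0)
    rw [hB]; linear_combination (-((Pp * Pm)⁻¹ * (1 + f ⬝ᵥ u))) * hA
  rw [hB', ← hκ, hG1]
  have h3 : 2 * (1 + f ⬝ᵥ u) * (Pp * Pm) = τ * ((1 + ξ * g * L) * (1 + g) * Pm ^ 2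
          + (1 - ξ * g * L) * (1 - g) * Pp ^ 2) := by
    rw [mul_add, hfu]
    linear_combination (1 - ξ * g * L) * Pp * hf2 - (1 + ξ * g * L) * Pm * hf1
  have h4 : 2 * (Pp * Pm) ^ 2 * ((Matrix.of fun j k : Fin n => χ ((j : ℤ) - k + 1) - χ k).det * (Pp * Pm)⁻¹ * (1 + f ⬝ᵥ u))
    = (Matrix.of fun j k : Fin n => χ ((j : ℤ) - k + 1) - χ k).det * (2 * (1 + f ⬝ᵥ u) * (Pp * Pm)) := by
    field_simp
  rw [h4, h3]; ring

theorem detA' {n : ℕ} (hn : Even n) (t e : Fin n → ℂ) (κ L g τ P : ℂ) (χ : ℤ → ℂ)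
    (h0 : ∀ i, t i ≠ 0) (hx : Function.Injective (fun i => t i ^ 2))
    (hxx : ∀ i l, 1 - t i ^ 2 * t l ^ 2 ≠ 0) (h2 : ∀ i, t i ^ 2 - 1 ≠ 0)
    (he : ∀ i, e i ^ 2 = 1) (hL : L ^ 2 = 1)
    (hK : ∀ i, ∏ m, ((t i ^ 2)⁻¹ - t m ^ 2)
      = κ * e i * lagD (fun i => t i ^ 2) i / (t i * (t i ^ 2 - 1)))
    (hχ : ∀ m : ℤ, g * χ m = L * ∑ i, e i * ((t i ^ 2) ^ m + (t i ^ 2) ^ (-m)))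
    (hτ : τ = ∏ i, t i) (hκP : κ = P * τ ^ 2) (hn0 : 0 < n) :
    g ^ n * (Matrix.of fun j k : Fin n => χ ((j : ℤ) - k + 1) - χ k).det
      * (∏ i, ∏ l ∈ univ.erase i, ((t i + (t i)⁻¹) + (t l + (t l)⁻¹))) * ∏ i, (t i + (t i)⁻¹)
      = (-1) ^ (n / 2) * P ^ n := by
  have q6 : ∀ i l, 1 + t i * t l ≠ 0 := by
    intro i l h; apply hxx i l; linear_combination (1 - t i * t l) * h
  have hinj : Function.Injective t := by
    intro i j h; apply hx; simp [h]
  have hτ0 : τ ≠ 0 := by rw [hτ]; exact Finset.prod_ne_zero_iff.mpr fun i _ => h0 i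
  have hC := det_cauK hn t h0 hinj q6
  rw [detA hn t e κ L g χ h0 hx hxx h2 he hL hK hχ, det_vand_sq hn]
  set Δt := ∏ i, ∏ l ∈ univ.erase i, (t i - t l) with hΔt
  set Δs := ∏ i, ∏ l ∈ univ.erase i, (t i + t l) with hΔs
  have hΔt0 : Δt ≠ 0 := Finset.prod_ne_zero_iff.mpr fun i _ => Finset.prod_ne_zero_iff.mpr
    fun l hl => sub_ne_zero.mpr fun h => (Finset.ne_of_mem_erase hl) (hinj h).symm
  have hsum : ∀ i l, i ≠ l → t i + t l ≠ 0 := by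
    intro i l hil h
    apply hil; apply hx; simp only; linear_combination (t i - t l) * h
  have hΔs0 : Δs ≠ 0 := Finset.prod_ne_zero_iff.mpr fun i _ => Finset.prod_ne_zero_iff.mpr
    fun l hl => hsum i l (Finset.ne_of_mem_erase hl).symm
  have hΔx : ∏ i, ∏ l ∈ univ.erase i, (t i ^ 2 - t l ^ 2) = Δt * Δs := by
    rw [hΔt, hΔs, ← Finset.prod_mul_distrib]
    refine Finset.prod_congr rfl fun i _ => ?_
    rw [← Finset.prod_mul_distrib]
    exact Finset.prod_congr rfl fun l _ => by ring
  have hD : (∏ l, lagD (fun i => t i ^ 2) l) = (Δt * Δs)⁻¹ := by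
    rw [← hΔx, ← Finset.prod_inv_distrib]
    refine Finset.prod_congr rfl fun i _ => ?_
    rw [lagD, Finset.prod_inv_distrib]
  set Y := ∏ i, ∏ l ∈ univ.erase i, (1 + t i * t l) with hY
  have hY0 : Y ≠ 0 := Finset.prod_ne_zero_iff.mpr fun i _ => Finset.prod_ne_zero_iff.mpr
    fun l hl => q6 i l
  have hq : ∏ i, (1 + t i * t i) = τ * ∏ i, (t i + (t i)⁻¹) := by
    rw [hτ, ← Finset.prod_mul_distrib]
    refine Finset.prod_congr rfl fun i _ => ?_
    have := h0 i
    field_simp; ring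
  have hYY : ∏ i, ∏ l, (1 + t i * t l) = (τ * ∏ i, (t i + (t i)⁻¹)) * Y := by
    rw [← hq, hY, ← Finset.prod_mul_distrib]
    refine Finset.prod_congr rfl fun i _ => ?_
    rw [Finset.mul_prod_erase univ (fun l => 1 + t i * t l) (mem_univ i)]
  have hX : τ ^ (2 * (n - 1)) * (∏ i, ∏ l ∈ univ.erase i, ((t i + (t i)⁻¹) + (t l + (t l)⁻¹))) = Δs * Y := by
    rw [hτ, ← prod_pair_mul, hΔs, hY, ← Finset.prod_mul_distrib, ← Finset.prod_mul_distrib]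
    refine Finset.prod_congr rfl fun i _ => ?_
    rw [← Finset.prod_mul_distrib, ← Finset.prod_mul_distrib]
    refine Finset.prod_congr rfl fun l _ => ?_
    have := h0 i; have := h0 l
    field_simp; ring
  rw [hYY] at hC
  have hq0 : ∏ i, (t i + (t i)⁻¹) ≠ 0 := by
    have : ∏ i, (1 + t i * t i) ≠ 0 := Finset.prod_ne_zero_iff.mpr fun i _ => q6 i i
    rw [hq] at this; exact right_ne_zero_of_mul this
  set q := ∏ i, (t i + (t i)⁻¹) with hqd
  set X := ∏ i, ∏ l ∈ univ.erase i, ((t i + (t i)⁻¹) + (t l + (t l)⁻¹)) with hXd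
  have hcau : (cauK t).det = Δt / (τ * q * Y) := by
    rw [eq_div_iff (mul_ne_zero (mul_ne_zero hτ0 hq0) hY0)]; exact hC
  have hXe : X = Δs * Y / τ ^ (2 * (n-1)) := by
    rw [eq_div_iff (pow_ne_zero _ hτ0), ← hX]; ring
  rw [hΔx, hD, hcau, hXe, hκP, Finset.prod_inv_distrib, ← hτ, mul_pow, ← pow_mul]
  have : τ ^ (2 * n) = τ ^ (2 * (n-1)) * τ ^ 2 := by rw [← pow_add]; congr 1; omega
  rw [this]
  field_simp

/-- the residues 1, ..., n -/
def rr (p : ℕ) {n : ℕ} (i : Fin n) : ZMod p := (((i : ℕ) + 1 : ℕ) : ZMod p)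

theorem pair_prod {M : Type*} [CommMonoid M] {p n : ℕ} [NeZero p] (hp : p = 2 * n + 1)
    (f : ZMod p → M) :
    ∏ r ∈ univ.erase (0 : ZMod p), f r
      = ∏ i : Fin n, (f (rr p i) * f (-(rr p i))) := by
  have h1 : ∏ r ∈ univ.erase (0 : ZMod p), f r = ∏ k ∈ range (2 * n), f ((k + 1 : ℕ)) := by
    refine Finset.prod_bij' (fun r _ => r.val - 1) (fun k _ => ((k + 1 : ℕ) : ZMod p)) ?_ ?_ ?_ ?_ ?_
    · intro r hr
      have h0 : r.val ≠ 0 := by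
        simpa [ZMod.val_eq_zero] using (Finset.mem_erase.mp hr).1
      have := ZMod.val_lt r
      simp only [Finset.mem_range]; omega
    · intro k hk
      simp only [Finset.mem_range] at hk
      simp only [Finset.mem_erase, Finset.mem_univ, and_true]
      intro h
      rw [ZMod.natCast_eq_zero_iff] at h
      have := Nat.le_of_dvd (by omega) h
      omega
    · intro r hr
      have h0 : r.val ≠ 0 := by
        simpa [ZMod.val_eq_zero] using (Finset.mem_erase.mp hr).1
      have : r.val - 1 + 1 = r.val := by omega
      simp only [this, ZMod.natCast_zmod_val]
    · intro k hk
      simp only [Finset.mem_range] at hk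
      rw [ZMod.val_natCast_of_lt (by omega)]; omega
    · intro r hr
      have h0 : r.val ≠ 0 := by
        simpa [ZMod.val_eq_zero] using (Finset.mem_erase.mp hr).1
      have : r.val - 1 + 1 = r.val := by omega
      simp only [this, ZMod.natCast_zmod_val]
  rw [h1, two_mul, Finset.prod_range_add, Finset.prod_mul_distrib,
    Finset.prod_range (fun k => f ((k + 1 : ℕ)))]
  simp only [rr]
  congr 1
  rw [← Finset.prod_range_reflect, Finset.prod_range]
  refine Finset.prod_congr rfl fun i _ => ?_
  congr 1
  rw [eq_neg_iff_add_eq_zero, ← Nat.cast_add, ZMod.natCast_eq_zero_iff]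
  have := i.2
  exact ⟨1, by omega⟩

theorem pair_sum {M : Type*} [AddCommMonoid M] {p n : ℕ} [NeZero p] (hp : p = 2 * n + 1)
    (f : ZMod p → M) :
    ∑ r ∈ univ.erase (0 : ZMod p), f r
      = ∑ i : Fin n, (f (rr p i) + f (-(rr p i))) :=
  pair_prod (M := Multiplicative M) hp f

section
variable {p : ℕ} [hpf : Fact p.Prime]

theorem psi_inj : Function.Injective (ZMod.stdAddChar (N := p)) := ZMod.injective_stdAddChar

theorem psi_pow (r : ZMod p) : (ZMod.stdAddChar (N := p) r) ^ p = 1 := by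
  rw [← AddChar.map_nsmul_eq_pow]
  simp

open Polynomial in
theorem psi_poly : ∏ r : ZMod p, (X - C (ZMod.stdAddChar (N := p) r)) = (X ^ p - 1 : ℂ[X]) := by
  have hp := hpf.out
  have h1 : IsPrimitiveRoot (ZMod.stdAddChar (N := p) 1) p := by
    have := Complex.isPrimitiveRoot_exp p hp.ne_zero
    convert this using 1
    have := ZMod.stdAddChar_coe (N := p) 1
    simpa using this
  rw [X_pow_sub_one_eq_prod hp.pos h1]
  refine Finset.prod_bij (fun r _ => ZMod.stdAddChar (N := p) r) ?_ ?_ ?_ ?_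
  · intro r _
    rw [Polynomial.mem_nthRootsFinset hp.pos]; exact psi_pow r
  · intro a _ b _ h; exact psi_inj h
  · intro z hz
    rw [Polynomial.mem_nthRootsFinset hp.pos] at hz
    obtain ⟨i, hi, h⟩ := h1.eq_pow_of_pow_eq_one hz
    refine ⟨(i : ZMod p), mem_univ _, ?_⟩
    rw [← h, ← AddChar.map_nsmul_eq_pow]; simp
  · intros; rfl

open Polynomial in
theorem psi_poly' {n : ℕ} (hpn : p = 2 * n + 1) (c : ZMod p) (hc : c ≠ 0) :
    (X - 1) * ∏ i : Fin n, ((X - C (ZMod.stdAddChar (N := p) (c * rr p i)))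
      * (X - C (ZMod.stdAddChar (N := p) (c * rr p i))⁻¹)) = (X ^ p - 1 : ℂ[X]) := by
  have h := Fintype.prod_equiv (Equiv.mulLeft₀ c hc)
    (fun r => X - C (ZMod.stdAddChar (N := p) (c * r))) (fun r => X - C (ZMod.stdAddChar (N := p) r))
    (fun r => by simp)
  rw [← psi_poly, ← h, ← Finset.mul_prod_erase univ _ (mem_univ (0 : ZMod p)), pair_prod hpn]
  congr 1
  · simp
  · refine Finset.prod_congr rfl fun i _ => ?_
    rw [mul_neg, AddChar.map_neg_eq_inv]
end

open Polynomial in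
theorem deriv_aux {p : ℕ} (a : ℂ) (R : ℂ[X]) (h : (X - C a) * R = X ^ p - 1) :
    R.eval a = p * a ^ (p - 1) := by
  have := congrArg (fun f => (derivative f).eval a) h
  simpa [derivative_X_pow] using this

open Polynomial in
theorem zfacts {p n : ℕ} (hpn : p = 2 * n + 1) (z : Fin n → ℂ) (hz : ∀ i, z i ^ p = 1)
    (h : (X - 1) * ∏ i, ((X - C (z i)) * (X - C (z i)⁻¹)) = (X ^ p - 1 : ℂ[X])) :
    (∏ i, ((1 - z i) * (1 - (z i)⁻¹)) = p) ∧ (∏ i, ((1 + z i) * (1 + (z i)⁻¹)) = 1) ∧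
    ∀ i, (z i - 1) * (∏ l ∈ univ.erase i, (z i - z l)) * ∏ l, (z i - (z l)⁻¹) = p * (z i)⁻¹ := by
  refine ⟨?_, ?_, ?_⟩
  · have h' := deriv_aux (p := p) 1 (∏ i, ((X - C (z i)) * (X - C (z i)⁻¹))) (by simpa using h)
    simpa [eval_prod] using h'
  · have h' := congrArg (eval (-1)) h
    have hodd : Odd p := ⟨n, hpn⟩
    simp [eval_prod, hodd.neg_one_pow] at h'
    have h2 : ∏ i, ((1 + z i) * (1 + (z i)⁻¹)) = ∏ i, ((-1 - z i) * (-1 - (z i)⁻¹)) :=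
      Finset.prod_congr rfl fun i _ => by ring
    rw [h2]
    linear_combination (-1/2) * h'
  · intro i
    have hz0 : z i ≠ 0 := by
      intro h0; have := hz i; rw [h0, zero_pow (by omega)] at this; exact zero_ne_one this
    have h' := deriv_aux (p := p) (z i) ((X - 1) * (∏ l ∈ univ.erase i, (X - C (z l)))
      * ∏ l, (X - C (z l)⁻¹)) (by
        rw [← h, Finset.prod_mul_distrib, ← Finset.mul_prod_erase univ (fun l => X - C (z l)) (mem_univ i)]
        ring)
    simp only [eval_mul, eval_prod, eval_sub, eval_X, eval_C, eval_one] at h'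
    rw [h']
    congr 1
    have := hz i
    apply eq_inv_of_mul_eq_one_left
    rw [← pow_succ, show p - 1 + 1 = p by omega, this]

/-- the hypotheses hK and hκ from the product facts -/
theorem hK_aux {p n : ℕ} (hn : Even n) (t e : Fin n → ℂ) (h0 : ∀ i, t i ≠ 0)
    (hx : Function.Injective (fun i => t i ^ 2)) (h2 : ∀ i, t i ^ 2 - 1 ≠ 0)
    (he : ∀ i, (t i ^ 2) ^ (n + 1) = e i * t i) (he2 : ∀ i, e i ^ 2 = 1)
    (h3 : ∀ i, (t i ^ 2 - 1) * (∏ l ∈ univ.erase i, (t i ^ 2 - t l ^ 2)) * ∏ l, (t i ^ 2 - (t l ^ 2)⁻¹)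
      = p * (t i ^ 2)⁻¹) (i : Fin n) :
    ∏ m, ((t i ^ 2)⁻¹ - t m ^ 2)
      = (p * (∏ l, t l) ^ 2) * e i * lagD (fun i => t i ^ 2) i / (t i * (t i ^ 2 - 1)) := by
  have h := h3 i
  have hD : ∏ l ∈ univ.erase i, (t i ^ 2 - t l ^ 2) ≠ 0 :=
    Finset.prod_ne_zero_iff.mpr fun l hl => sub_ne_zero.mpr fun h => (Finset.ne_of_mem_erase hl) (hx h).symm
  have hl : lagD (fun i => t i ^ 2) i = (∏ l ∈ univ.erase i, (t i ^ 2 - t l ^ 2))⁻¹ := by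
    rw [lagD, Finset.prod_inv_distrib]
  have hc : (t i ^ 2) ^ n * ∏ m, ((t i ^ 2)⁻¹ - t m ^ 2) = (∏ l, t l) ^ 2 * ∏ l, (t i ^ 2 - (t l ^ 2)⁻¹) := by
    have e1 : (t i ^ 2) ^ n = ∏ _m : Fin n, (- (t i ^ 2)) := by
      simp [hn.neg_pow]
    rw [e1, ← Finset.prod_pow, ← Finset.prod_mul_distrib, ← Finset.prod_mul_distrib]
    refine Finset.prod_congr rfl fun l _ => ?_
    have := h0 l; have := h0 i
    field_simp
    ring
  rw [hl]
  set D := ∏ l ∈ univ.erase i, (t i ^ 2 - t l ^ 2)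
  have a := h0 i; have b := h2 i
  rw [eq_div_iff (mul_ne_zero a b), ← div_eq_mul_inv, eq_div_iff hD]
  have hx0 : (t i ^ 2) ^ (n + 1) ≠ 0 := pow_ne_zero _ (pow_ne_zero _ a)
  apply mul_left_cancel₀ hx0
  have h' : (t i ^ 2 - 1) * D * (∏ l, (t i ^ 2 - (t l ^ 2)⁻¹)) * t i ^ 2 = p := by
    rw [h]; field_simp
  have he' := he i
  have h22 := he2 i
  calc _ = ((t i ^ 2) ^ n * ∏ m, ((t i ^ 2)⁻¹ - t m ^ 2)) * t i ^ 2 * (t i * (t i ^ 2 - 1)) * D := by ring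
    _ = (∏ l, t l) ^ 2 * t i * ((t i ^ 2 - 1) * D * (∏ l, (t i ^ 2 - (t l ^ 2)⁻¹)) * t i ^ 2) := by
        rw [hc]; ring
    _ = _ := by rw [h', he']; linear_combination (-(∏ l, t l) ^ 2 * t i * p) * h22

theorem hκ_aux {p n : ℕ} (hn : Even n) (t : Fin n → ℂ) (h0 : ∀ i, t i ≠ 0)
    (h1 : ∏ i, ((1 - t i ^ 2) * (1 - (t i ^ 2)⁻¹)) = (p : ℂ)) :
    (∏ i, (1 - t i ^ 2)) ^ 2 = p * (∏ l, t l) ^ 2 := by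
  rw [← h1, ← Finset.prod_pow, ← Finset.prod_pow, ← Finset.prod_mul_distrib]
  have : ∏ i, (1 - t i ^ 2) ^ 2 = ∏ i, ((-1) * (1 - t i ^ 2) ^ 2) := by
    rw [Finset.prod_mul_distrib]; simp [hn.neg_one_pow]
  rw [this]
  refine Finset.prod_congr rfl fun l _ => ?_
  have := h0 l
  field_simp; ring

section
variable {p : ℕ} [hpf : Fact p.Prime]

/-- complex-valued quadratic character -/
noncomputable def qc (r : ZMod p) : ℂ := ((quadraticChar (ZMod p) r : ℤ) : ℂ)

theorem qc_leg (m : ℤ) : ((legendreSym p m : ℤ) : ℂ) = qc (p := p) (m : ZMod p) := rfl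

theorem qc_mul (a b : ZMod p) : qc (a * b) = qc a * qc b := by
  simp only [qc, map_mul, Int.cast_mul]

theorem qc_zero : qc (0 : ZMod p) = 0 := by simp [qc]

theorem qc_sq {a : ZMod p} (ha : a ≠ 0) : qc a ^ 2 = 1 := by
  have := quadraticChar_sq_one (F := ZMod p) ha
  rw [qc]; exact_mod_cast this

theorem qc_neg_one (hp4 : p % 4 = 1) : qc (-1 : ZMod p) = 1 := by
  have : quadraticChar (ZMod p) (-1) = 1 := by
    rw [quadraticChar_one_iff_isSquare (by simp)]
    rw [ZMod.exists_sq_eq_neg_one_iff]; omega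
  rw [qc, this]; simp

theorem qc_neg (hp4 : p % 4 = 1) (a : ZMod p) : qc (-a) = qc a := by
  rw [← neg_one_mul, qc_mul, qc_neg_one hp4, one_mul]

theorem ne_two (hp4 : p % 4 = 1) : p ≠ 2 := by omega

theorem two_ne (hp4 : p % 4 = 1) : (2 : ZMod p) ≠ 0 := by
  intro h
  have : ((2 : ℕ) : ZMod p) = 0 := by exact_mod_cast h
  rw [ZMod.natCast_eq_zero_iff] at this
  have := Nat.le_of_dvd (by norm_num) this
  have := hpf.out.two_le
  omega

theorem ringChar_ne (hp4 : p % 4 = 1) : ringChar (ZMod p) ≠ 2 := by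
  rw [ZMod.ringChar_zmod_n]; exact ne_two hp4

/-- the quadratic Gauss sum -/
noncomputable def gs (p : ℕ) [Fact p.Prime] : ℂ := ∑ r : ZMod p, qc r * ZMod.stdAddChar r

theorem qc_sum (hp4 : p % 4 = 1) : ∑ r : ZMod p, qc r = 0 := by
  have := quadraticChar_sum_zero (ringChar_ne hp4)
  simp only [qc]; exact_mod_cast this

theorem gs_shift (hp4 : p % 4 = 1) (m : ZMod p) :
    qc m * gs p = ∑ r : ZMod p, qc r * ZMod.stdAddChar (m * r) := by
  rcases eq_or_ne m 0 with h | h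
  · subst h; simp [qc_zero, qc_sum hp4]
  · rw [gs, Finset.mul_sum]
    have h2 := Fintype.sum_equiv (Equiv.mulLeft₀ m h)
      (fun r => qc m * (qc (m * r) * ZMod.stdAddChar (m * r)))
      (fun r => qc m * (qc r * ZMod.stdAddChar r)) (fun r => by simp)
    rw [← h2]
    refine Finset.sum_congr rfl fun r _ => ?_
    rw [qc_mul]; linear_combination (qc r * ZMod.stdAddChar (m * r)) * qc_sq h

theorem gs_sq (hp4 : p % 4 = 1) : gs p ^ 2 = p := by
  have h := gaussSum_sq (χ := (quadraticChar (ZMod p)).ringHomComp (Int.castRingHom ℂ))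
    (ψ := ZMod.stdAddChar) ?_ ?_ (ZMod.isPrimitive_stdAddChar p)
  · have h1 : gaussSum ((quadraticChar (ZMod p)).ringHomComp (Int.castRingHom ℂ)) ZMod.stdAddChar = gs p := by
      rfl
    rw [h1] at h
    rw [h]
    have := qc_neg_one hp4
    simp only [qc] at this
    rw [ZMod.card, MulChar.ringHomComp_apply, eq_intCast, this, one_mul]
  · rw [MulChar.ringHomComp_ne_one_iff (RingHom.injective_int (Int.castRingHom ℂ))]
    exact quadraticChar_ne_one (ringChar_ne hp4)
  · exact (quadraticChar_isQuadratic (ZMod p)).comp _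

theorem half_sum {n : ℕ} (hpn : p = 2 * n + 1) (hp4 : p % 4 = 1) (m : ZMod p) :
    qc m * gs p = ∑ i : Fin n, qc (rr p i) *
      (ZMod.stdAddChar (m * rr p i) + (ZMod.stdAddChar (m * rr p i))⁻¹) := by
  rw [gs_shift hp4, ← Finset.add_sum_erase univ _ (mem_univ (0 : ZMod p)), pair_sum hpn, qc_zero, zero_mul, zero_add]
  refine Finset.sum_congr rfl fun i _ => ?_
  rw [qc_neg hp4, mul_neg, AddChar.map_neg_eq_inv]; ring
end

section
variable {p : ℕ} [hpf : Fact p.Prime]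

/-- the numbers χ(r) ζ^{-r} -/
noncomputable def tt (r : ZMod p) : ℂ := qc r * ZMod.stdAddChar (-r)

theorem psi_ne (r : ZMod p) : ZMod.stdAddChar r ≠ 0 := by
  intro h
  have := psi_pow r
  rw [h, zero_pow hpf.out.ne_zero] at this
  exact zero_ne_one this

theorem qc_ne {r : ZMod p} (hr : r ≠ 0) : qc r ≠ 0 := by
  intro h
  have := qc_sq hr
  rw [h] at this; simp at this

theorem tt_ne {r : ZMod p} (hr : r ≠ 0) : tt r ≠ 0 := mul_ne_zero (qc_ne hr) (psi_ne _)

theorem tt_neg (hp4 : p % 4 = 1) {r : ZMod p} (hr : r ≠ 0) : tt (-r) = (tt r)⁻¹ := by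
  apply eq_inv_of_mul_eq_one_left
  rw [tt, tt, qc_neg hp4, neg_neg, AddChar.map_neg_eq_inv]
  have := psi_ne r
  have h2 := qc_sq hr
  field_simp
  exact h2

theorem psi_norm (r : ZMod p) : ‖ZMod.stdAddChar r‖ = 1 := by
  have h := psi_pow r
  exact Complex.norm_eq_one_of_pow_eq_one h hpf.out.ne_zero

theorem qc_norm {r : ZMod p} (hr : r ≠ 0) : ‖qc r‖ = 1 := by
  exact Complex.norm_eq_one_of_pow_eq_one (qc_sq hr) two_ne_zero

theorem tt_norm {r : ZMod p} (hr : r ≠ 0) : ‖tt r‖ = 1 := by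
  rw [tt, norm_mul, qc_norm hr, psi_norm, one_mul]

theorem rr_ne {n : ℕ} (hpn : p = 2 * n + 1) (i : Fin n) : rr p i ≠ 0 := by
  rw [rr, Ne, ZMod.natCast_eq_zero_iff]
  intro h
  have := Nat.le_of_dvd (by omega) h
  have := i.2; omega

theorem rr_inj {n : ℕ} (hpn : p = 2 * n + 1) : Function.Injective (rr p (n := n)) := by
  intro i j h
  simp only [rr] at h
  rw [ZMod.natCast_eq_natCast_iff'] at h
  have := i.2; have := j.2
  rw [Nat.mod_eq_of_lt (by omega), Nat.mod_eq_of_lt (by omega)] at h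
  ext; omega

theorem rr_add_ne {n : ℕ} (hpn : p = 2 * n + 1) (i j : Fin n) : rr p i ≠ - rr p j := by
  intro h
  rw [eq_neg_iff_add_eq_zero, rr, rr, ← Nat.cast_add, ZMod.natCast_eq_zero_iff] at h
  have := Nat.le_of_dvd (by omega) h
  have := i.2; have := j.2; omega

/-- off-diagonal norm -/
noncomputable def NN (r s : ZMod p) : ℝ := if s = r ∨ s = -r then 1 else ‖tt r + tt s‖

theorem NN_neg (hp4 : p % 4 = 1) {r s : ZMod p} (hr : r ≠ 0) (hs : s ≠ 0) : NN (-r) (-s) = NN r s := by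
  unfold NN
  have e : (-s = -r ∨ -s = - -r) ↔ (s = r ∨ s = -r) := by
    rw [_root_.neg_inj, neg_neg, neg_eq_iff_eq_neg]
  simp only [e]
  split_ifs
  · rfl
  · rw [tt_neg hp4 hr, tt_neg hp4 hs]
    have a := tt_ne hr; have b := tt_ne hs
    have : (tt r)⁻¹ + (tt s)⁻¹ = (tt r + tt s) * ((tt r)⁻¹ * (tt s)⁻¹) := by field_simp; ring
    rw [this, norm_mul, norm_mul, norm_inv, norm_inv, tt_norm hr, tt_norm hs]; simp

theorem X_norm {n : ℕ} (hpn : p = 2 * n + 1) (hp4 : p % 4 = 1) :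
    ‖∏ i : Fin n, ∏ l ∈ univ.erase i, ((tt (rr p i) + (tt (rr p i))⁻¹) + (tt (rr p l) + (tt (rr p l))⁻¹))‖ ^ 2
      = ∏ r ∈ univ.erase (0 : ZMod p), ∏ s ∈ univ.erase (0 : ZMod p), NN r s := by
  have h1 : ∀ i : Fin n, ∏ s ∈ univ.erase (0 : ZMod p), NN (rr p i) s
      = ∏ l ∈ univ.erase i, ‖(tt (rr p i) + (tt (rr p i))⁻¹) + (tt (rr p l) + (tt (rr p l))⁻¹)‖ := by
    intro i
    rw [pair_prod hpn, ← Finset.mul_prod_erase univ _ (mem_univ i)]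
    have e1 : NN (rr p i) (rr p i) * NN (rr p i) (-rr p i) = 1 := by simp [NN]
    rw [e1, one_mul]
    refine Finset.prod_congr rfl fun l hl => ?_
    have hne : l ≠ i := Finset.ne_of_mem_erase hl
    have n1 : rr p l ≠ rr p i := fun h => hne (rr_inj hpn h)
    have n2 := rr_add_ne hpn l i
    have n3 : - rr p l ≠ rr p i := fun h => rr_add_ne hpn i l h.symm
    have n4 : - rr p l ≠ - rr p i := fun h => n1 (neg_injective h)
    simp only [NN, n1, n2, n3, n4, or_self, if_false]
    rw [tt_neg hp4 (rr_ne hpn l)]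
    have a := tt_ne (rr_ne hpn l); have b := tt_ne (rr_ne hpn i)
    have : tt (rr p i) + (tt (rr p i))⁻¹ + (tt (rr p l) + (tt (rr p l))⁻¹)
      = (tt (rr p i) + tt (rr p l)) * (tt (rr p i) + (tt (rr p l))⁻¹) * (tt (rr p i))⁻¹ := by
      field_simp; ring
    rw [this, norm_mul, norm_mul, norm_inv, tt_norm (rr_ne hpn i)]; simp
  rw [norm_prod, pair_prod hpn, ← Finset.prod_pow]
  refine Finset.prod_congr rfl fun i _ => ?_
  have h2 : ∏ s ∈ univ.erase (0 : ZMod p), NN (-rr p i) s = ∏ s ∈ univ.erase (0 : ZMod p), NN (rr p i) s := by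
    refine Finset.prod_bij' (fun s _ => -s) (fun s _ => -s) ?_ ?_ ?_ ?_ ?_
    · intro s hs; simpa using hs
    · intro s hs; simpa using hs
    · intros; simp
    · intros; simp
    · intro s hs
      have hs : s ≠ 0 := Finset.ne_of_mem_erase hs
      rw [← NN_neg hp4 (r := rr p i) (s := -s) (rr_ne hpn i) (by simpa using hs), neg_neg]
  rw [h2, h1, norm_prod, sq]

theorem prod_one_add_psi {n : ℕ} (hpn : p = 2 * n + 1) (c : ZMod p) (hc : c ≠ 0) :
    ∏ r ∈ univ.erase (0 : ZMod p), (1 + ZMod.stdAddChar (c * r)) = 1 := by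
  have h := (zfacts hpn (fun i => ZMod.stdAddChar (c * rr p i)) (fun i => psi_pow _) (psi_poly' hpn c hc)).2.1
  rw [pair_prod hpn]
  refine Eq.trans (Finset.prod_congr rfl fun i _ => ?_) h
  rw [mul_neg, AddChar.map_neg_eq_inv]

theorem prod_one_sub_psi {n : ℕ} (hpn : p = 2 * n + 1) (c : ZMod p) (hc : c ≠ 0) :
    ∏ r ∈ univ.erase (0 : ZMod p), (1 - ZMod.stdAddChar (c * r)) = p := by
  have h := (zfacts hpn (fun i => ZMod.stdAddChar (c * rr p i)) (fun i => psi_pow _) (psi_poly' hpn c hc)).1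
  rw [pair_prod hpn, ← h]
  refine Finset.prod_congr rfl fun i _ => ?_
  rw [mul_neg, AddChar.map_neg_eq_inv]

theorem NN_prod {n : ℕ} (hpn : p = 2 * n + 1) (hp4 : p % 4 = 1) :
    ∏ r ∈ univ.erase (0 : ZMod p), ∏ s ∈ univ.erase (0 : ZMod p), NN r s = (p : ℝ) ^ n := by
  have h1 : ∀ r ∈ univ.erase (0 : ZMod p), ∏ s ∈ univ.erase (0 : ZMod p), NN r s
      = ∏ u ∈ univ.erase (0 : ZMod p), (if u = 1 ∨ u = -1 then 1 else ‖1 + qc u * ZMod.stdAddChar ((1 - u) * r)‖) := by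
    intro r hr
    have hr : r ≠ 0 := Finset.ne_of_mem_erase hr
    symm
    refine Finset.prod_bij' (fun u _ => u * r) (fun s _ => s * r⁻¹) ?_ ?_ ?_ ?_ ?_
    · intro u hu
      simp only [Finset.mem_erase, Finset.mem_univ, and_true] at hu ⊢
      exact mul_ne_zero hu hr
    · intro u hu
      simp only [Finset.mem_erase, Finset.mem_univ, and_true] at hu ⊢
      exact mul_ne_zero hu (inv_ne_zero hr)
    · intro u hu; simp [hr]
    · intro u hu; simp [hr]
    · intro u hu
      have e1 : u * r = r ↔ u = 1 := by
        constructor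
        · intro h; exact mul_right_cancel₀ hr (by rw [h, one_mul])
        · rintro rfl; simp
      have e2 : u * r = -r ↔ u = -1 := by
        constructor
        · intro h; exact mul_right_cancel₀ hr (by rw [h, neg_one_mul])
        · rintro rfl; simp
      simp only [NN, e1, e2]
      split_ifs
      · rfl
      · have : tt r + tt (u * r) = tt r * (1 + qc u * ZMod.stdAddChar ((1 - u) * r)) := by
          have : ZMod.stdAddChar (-(u * r)) = ZMod.stdAddChar (-r) * ZMod.stdAddChar ((1 - u) * r) := by
            rw [← AddChar.map_add_eq_mul]; congr 1; ring
          rw [tt, tt, qc_mul, this]; ring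
        rw [this, norm_mul, tt_norm hr, one_mul]
  rw [Finset.prod_congr rfl h1, Finset.prod_comm]
  have h2 : ∀ u ∈ univ.erase (0 : ZMod p), ∏ r ∈ univ.erase (0 : ZMod p),
      (if u = 1 ∨ u = -1 then 1 else ‖1 + qc u * ZMod.stdAddChar ((1 - u) * r)‖)
      = (p : ℝ) ^ (if quadraticChar (ZMod p) u = -1 then 1 else 0) := by
    intro u hu
    have hu : u ≠ 0 := Finset.ne_of_mem_erase hu
    by_cases h : u = 1 ∨ u = -1
    · simp only [h, if_true, Finset.prod_const_one]
      have h3 : quadraticChar (ZMod p) u = 1 := by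
        rcases h with h | h
        · rw [h]; simp
        · have := qc_neg_one hp4
          rw [h]; unfold qc at this; exact_mod_cast this
      rw [h3]; norm_num
    · simp only [h, if_false]
      have hc : (1 - u) ≠ 0 := fun h' => h (Or.inl (sub_eq_zero.mp h').symm)
      rw [← norm_prod]
      rcases quadraticChar_dichotomy hu with h3 | h3
      · have : qc u = 1 := by rw [qc, h3]; simp
        rw [h3]; simp only [this, one_mul]
        rw [prod_one_add_psi hpn _ hc]; norm_num
      · have : qc u = -1 := by rw [qc, h3]; simp
        rw [h3]; simp only [this, neg_one_mul, ← sub_eq_add_neg]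
        rw [prod_one_sub_psi hpn _ hc]; simp
  rw [Finset.prod_congr rfl h2, Finset.prod_pow_eq_pow_sum]
  congr 1
  have h4 : ∑ u ∈ univ.erase (0 : ZMod p), quadraticChar (ZMod p) u = 0 := by
    rw [← quadraticChar_sum_zero (ringChar_ne hp4), ← Finset.add_sum_erase univ _ (mem_univ (0 : ZMod p))]
    simp
  have h5 : ∑ u ∈ univ.erase (0 : ZMod p), (1 : ℤ) = 2 * n := by
    simp [ZMod.card, hpn]
  have h6 : ∑ u ∈ univ.erase (0 : ZMod p), (1 : ℤ) - ∑ u ∈ univ.erase (0 : ZMod p), quadraticChar (ZMod p) u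
     = 2 * ∑ u ∈ univ.erase (0 : ZMod p), (((if quadraticChar (ZMod p) u = -1 then 1 else 0 : ℕ)) : ℤ) := by
    rw [Finset.mul_sum, ← Finset.sum_sub_distrib]
    refine Finset.sum_congr rfl fun u hu => ?_
    have hu : u ≠ 0 := Finset.ne_of_mem_erase hu
    rcases quadraticChar_dichotomy hu with h3 | h3 <;> rw [h3] <;> norm_num
  rw [h4, h5, ← Nat.cast_sum] at h6
  omega
end

section
variable {p : ℕ} [hpf : Fact p.Prime]

theorem psi_exp (k : ℕ) : ZMod.stdAddChar (N := p) (k : ZMod p) = Complex.exp (2 * Real.pi * Complex.I * k / p) := by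
  have := ZMod.stdAddChar_coe (N := p) (k : ℤ)
  simpa using this

theorem tt_cos {n : ℕ} (hpn : p = 2 * n + 1) (hp4 : p % 4 = 1) (i : Fin n) :
    tt (rr p i) + (tt (rr p i))⁻¹
      = (((quadraticChar (ZMod p) (rr p i) : ℤ) * (2 * Real.cos (2 * Real.pi * ((i : ℕ) + 1 : ℕ) / p)) : ℝ) : ℂ) := by
  rw [← tt_neg hp4 (rr_ne hpn i), tt, tt, qc_neg hp4, neg_neg, ← mul_add, AddChar.map_neg_eq_inv, qc]
  have h1 : ZMod.stdAddChar (rr p i) = Complex.exp ((2 * Real.pi * ((i : ℕ) + 1 : ℕ) / p : ℝ) * Complex.I) := by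
    rw [rr, psi_exp]; congr 1; push_cast; ring
  rw [h1, ← Complex.exp_neg]
  rw [Complex.ofReal_mul, Complex.ofReal_mul, Complex.ofReal_cos, Complex.cos]
  push_cast
  ring_nf

theorem X_eq {n m : ℕ} (hpn : p = 2 * n + 1) (hnm : n = 2 * m) (hp4 : p % 4 = 1) :
    ∏ i : Fin n, ∏ l ∈ univ.erase i, ((tt (rr p i) + (tt (rr p i))⁻¹) + (tt (rr p l) + (tt (rr p l))⁻¹))
      = (p : ℂ) ^ m := by
  have h := X_norm hpn hp4
  rw [NN_prod hpn hp4] at h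
  obtain ⟨y, hy⟩ : ∃ y : ℝ, ∏ i : Fin n, ∏ l ∈ univ.erase i, ((tt (rr p i) + (tt (rr p i))⁻¹) + (tt (rr p l) + (tt (rr p l))⁻¹))
      = ((y ^ 2 : ℝ) : ℂ) := by
    have h1 := prod_Ioi_sq (fun l i : Fin n => ((tt (rr p i) + (tt (rr p i))⁻¹) + (tt (rr p l) + (tt (rr p l))⁻¹)))
    rw [h1]
    simp only [tt_cos hpn hp4]
    refine ⟨∏ i : Fin n, ∏ j ∈ Ioi i, (((quadraticChar (ZMod p) (rr p i) : ℤ) * (2 * Real.cos (2 * Real.pi * ((i : ℕ) + 1 : ℕ) / p)))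
      + ((quadraticChar (ZMod p) (rr p j) : ℤ) * (2 * Real.cos (2 * Real.pi * ((j : ℕ) + 1 : ℕ) / p)))), ?_⟩
    rw [← Finset.prod_pow]
    simp only [← Finset.prod_pow]
    rw [Complex.ofReal_prod]
    refine Finset.prod_congr rfl fun i _ => ?_
    rw [Complex.ofReal_prod]
    refine Finset.prod_congr rfl fun j _ => ?_
    push_cast; ring
  rw [hy] at h ⊢
  rw [Complex.norm_real, Real.norm_of_nonneg (sq_nonneg y), hnm, mul_comm 2 m, pow_mul] at h
  have h2 : y ^ 2 = (p : ℝ) ^ m := by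
    rwa [sq_eq_sq₀ (sq_nonneg y) (by positivity)] at h
  rw [h2]; simp

theorem prod_cos {n m : ℕ} (hpn : p = 2 * n + 1) (hnm : n = 2 * m) :
    ∏ i : Fin n, (2 * Real.cos (2 * Real.pi * ((i : ℕ) + 1 : ℕ) / p)) = (-1) ^ m := by
  have hp0 : (0 : ℝ) < p := by exact_mod_cast hpf.out.pos
  set c : ℕ → ℝ := fun i => 2 * Real.cos (2 * Real.pi * ((i : ℕ) + 1 : ℕ) / p) with hc
  have hsq : (∏ i : Fin n, c i) ^ 2 = 1 := by
    have h := prod_one_add_psi hpn 1 one_ne_zero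
    rw [pair_prod hpn] at h
    have h2 : ((∏ i : Fin n, c i : ℝ) : ℂ) ^ 2 = ∏ i : Fin n, (1 + ZMod.stdAddChar (2 * rr p i)) * (1 + ZMod.stdAddChar (2 * -rr p i)) := by
      rw [Complex.ofReal_prod, ← Finset.prod_pow]
      refine Finset.prod_congr rfl fun i _ => ?_
      have h1 : ZMod.stdAddChar (rr p i) = Complex.exp ((2 * Real.pi * ((i : ℕ) + 1 : ℕ) / p : ℝ) * Complex.I) := by
        rw [rr, psi_exp]; congr 1; push_cast; ring
      have h3 : ((c i : ℝ) : ℂ) = ZMod.stdAddChar (rr p i) + (ZMod.stdAddChar (rr p i))⁻¹ := by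
        rw [h1, ← Complex.exp_neg, hc]
        rw [Complex.ofReal_mul, Complex.ofReal_cos, Complex.cos]
        push_cast; ring_nf
      rw [h3, mul_neg, AddChar.map_neg_eq_inv, two_mul, AddChar.map_add_eq_mul]
      have := psi_ne (rr p i)
      field_simp
      ring
    have h4 := prod_one_add_psi hpn 2 (two_ne (by omega))
    rw [pair_prod hpn, ← h2] at h4
    exact_mod_cast h4
  have hpos : 0 < (-1) ^ m * ∏ i : Fin n, c i := by
    rw [← Finset.prod_range c, hnm, two_mul, Finset.prod_range_add]
    have e : (-1 : ℝ) ^ m = ∏ i ∈ range m, (-1 : ℝ) := by simp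
    rw [mul_left_comm, e, ← Finset.prod_mul_distrib]
    apply mul_pos
    · apply Finset.prod_pos
      intro i hi
      have hi := Finset.mem_range.mp hi
      apply mul_pos two_pos
      apply Real.cos_pos_of_mem_Ioo
      constructor
      · have : 0 ≤ 2 * Real.pi * ((i : ℕ) + 1 : ℕ) / p := by positivity
        linarith [Real.pi_pos]
      · rw [div_lt_iff₀ hp0]
        have : (4 * ((i + 1 : ℕ) : ℝ)) < p := by exact_mod_cast (by omega)
        nlinarith [Real.pi_pos]
    · apply Finset.prod_pos
      intro i hi
      have hi := Finset.mem_range.mp hi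
      have : Real.cos (2 * Real.pi * ((m + i : ℕ) + 1 : ℕ) / p) < 0 := by
        apply Real.cos_neg_of_pi_div_two_lt_of_lt
        · rw [lt_div_iff₀ hp0]
          have : (p : ℝ) < (4 * ((m + i + 1 : ℕ) : ℝ)) := by exact_mod_cast (by omega)
          nlinarith [Real.pi_pos]
        · rw [div_lt_iff₀ hp0]
          have : (2 * ((m + i + 1 : ℕ) : ℝ)) < p := by exact_mod_cast (by omega)
          nlinarith [Real.pi_pos]
      simp only [hc]; linarith
  have h1 : ((-1) ^ m * ∏ i : Fin n, c i) = 1 := by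
    have : ((-1) ^ m * ∏ i : Fin n, c i) ^ 2 = 1 := by
      rw [mul_pow, hsq, ← pow_mul, mul_comm m 2, pow_mul]; simp
    nlinarith
  have h2 : ((-1 : ℝ) ^ m) * (-1) ^ m = 1 := by rw [← mul_pow]; simp
  linear_combination ((-1) ^ m) * h1 - (∏ i : Fin n, c i) * h2

theorem rr_fact {n : ℕ} : ∏ i : Fin n, rr p i = ((n.factorial : ℕ) : ZMod p) := by
  rw [← Finset.prod_range_add_one_eq_factorial, Finset.prod_range, Nat.cast_prod]
  rfl

theorem fact_sq {n : ℕ} (hpn : p = 2 * n + 1) (hn : Even n) : ((n.factorial : ℕ) : ZMod p) ^ 2 = -1 := by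
  have h := pair_prod hpn (fun r => r)
  have h2 := FiniteField.prod_univ_units_id_eq_neg_one (K := ZMod p)
  have h3 : ∏ r ∈ univ.erase (0 : ZMod p), r = -1 := by
    have h2 := congrArg (fun u : (ZMod p)ˣ => (u : ZMod p)) h2
    simp only [Units.coe_prod, Units.val_neg, Units.val_one] at h2
    rw [← h2]
    symm
    refine Finset.prod_bij (fun u _ => (u : ZMod p)) ?_ ?_ ?_ ?_
    · intro u _; simp
    · intro a _ b _ h; exact Units.ext h
    · intro b hb; exact ⟨Units.mk0 b (Finset.ne_of_mem_erase hb), mem_univ _, rfl⟩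
    · intros; rfl
  rw [h3] at h
  rw [h, ← rr_fact, ← Finset.prod_pow]
  have : ∏ i : Fin n, rr p i ^ 2 = ∏ i : Fin n, ((-1) * rr p i ^ 2) := by
    rw [Finset.prod_mul_distrib]; simp [hn.neg_one_pow]
  rw [this]
  exact Finset.prod_congr rfl fun i _ => by ring

theorem pm_eq {a b : ℤ} (hp4 : p % 4 = 1) (ha : a = 1 ∨ a = -1) (hb : b = 1 ∨ b = -1)
    (h : (a : ZMod p) = b) : a = b := by
  have h2 := two_ne hp4
  rcases ha with rfl | rfl <;> rcases hb with rfl | rfl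
  · rfl
  · exfalso; apply h2; push_cast at h; linear_combination h
  · exfalso; apply h2; push_cast at h; linear_combination -h
  · rfl

theorem qchar_fact {n m : ℕ} (hpn : p = 2 * n + 1) (hnm : n = 2 * m) (hp4 : p % 4 = 1) :
    quadraticChar (ZMod p) ((n.factorial : ℕ) : ZMod p) = (-1) ^ m := by
  have hs := fact_sq hpn ⟨m, by omega⟩
  have hne : ((n.factorial : ℕ) : ZMod p) ≠ 0 := by
    intro h; rw [h] at hs; simp at hs
  apply pm_eq (p := p) hp4 (quadraticChar_dichotomy hne) (neg_one_pow_eq_or ℤ m)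
  rw [quadraticChar_eq_pow_of_char_ne_two' (ringChar_ne hp4), ZMod.card,
    show p / 2 = 2 * m by omega, pow_mul, hs]
  simp

theorem prod_qc {n m : ℕ} (hpn : p = 2 * n + 1) (hnm : n = 2 * m) (hp4 : p % 4 = 1) :
    ∏ i : Fin n, quadraticChar (ZMod p) (rr p i) = (-1) ^ m := by
  rw [← map_prod, rr_fact, qchar_fact hpn hnm hp4]

theorem prod_q {n m : ℕ} (hpn : p = 2 * n + 1) (hnm : n = 2 * m) (hp4 : p % 4 = 1) :
    ∏ i : Fin n, (tt (rr p i) + (tt (rr p i))⁻¹) = 1 := by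
  simp only [tt_cos hpn hp4]
  rw [← Complex.ofReal_prod, Finset.prod_mul_distrib, prod_cos hpn hnm, ← Int.cast_prod, prod_qc hpn hnm hp4]
  push_cast
  rw [← mul_pow]; simp

theorem qchar_two {n m : ℕ} (hpn : p = 2 * n + 1) (hnm : n = 2 * m) (hp4 : p % 4 = 1) :
    quadraticChar (ZMod p) 2 = (-1) ^ m := by
  rw [quadraticChar_two (ringChar_ne hp4), ZMod.card, ZMod.χ₈_nat_eq_if_mod_eight]
  rcases Nat.even_or_odd m with h | h
  · rw [h.neg_one_pow]; obtain ⟨k, hk⟩ := h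
    rw [if_neg (by omega), if_pos (by omega)]
  · rw [h.neg_one_pow]; obtain ⟨k, hk⟩ := h
    rw [if_neg (by omega), if_neg (by omega)]
end

section
variable {p : ℕ} [hpf : Fact p.Prime]
open Polynomial

theorem theta_pow (s : ℕ) (hs : s ≤ p - 1) : ∃ k : (ZMod p)[X],
    ∑ j ∈ range p, C ((j : ZMod p) ^ s) * X ^ j = (X - 1) ^ (p - 1 - s) * k
      ∧ k.eval 1 = (-1) ^ s * (s.factorial : ℕ) := by
  induction s with
  | zero =>
    refine ⟨1, ?_, by simp⟩
    simp only [pow_zero, C_1, one_mul, mul_one]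
    have h1 : (∑ j ∈ range p, (X : (ZMod p)[X]) ^ j) * (X - 1) = X ^ p - 1 := geom_sum_mul X p
    have h2 : ((X - 1) ^ (p - 1) : (ZMod p)[X]) * (X - 1) = X ^ p - 1 := by
      rw [← pow_succ, show p - 1 + 1 = p from Nat.succ_pred_prime hpf.out, sub_pow_char, one_pow]
    have h3 : (X - 1 : (ZMod p)[X]) ≠ 0 := by
      have := X_sub_C_ne_zero (1 : ZMod p); simpa using this
    exact mul_right_cancel₀ h3 (h1.trans h2.symm)
  | succ s ih =>
    obtain ⟨k, hk, hk1⟩ := ih (by omega)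
    refine ⟨X * (C ((p - 1 - s : ℕ) : ZMod p) * k + (X - 1) * derivative k), ?_, ?_⟩
    · have h := congrArg (fun f => X * derivative f) hk
      simp only [derivative_sum, derivative_mul, derivative_C, zero_mul, zero_add, derivative_X_pow,
        derivative_pow, derivative_sub, derivative_X, derivative_one, sub_zero, mul_one] at h
      have hl : X * ∑ x ∈ range p, C ((x : ZMod p) ^ s) * (C (x : ZMod p) * X ^ (x - 1))
        = ∑ j ∈ range p, C ((j : ZMod p) ^ (s + 1)) * X ^ j := by
        rw [Finset.mul_sum]
        refine Finset.sum_congr rfl fun j _ => ?_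
        rcases j with _ | j
        · simp
        · rw [pow_succ (((j + 1 : ℕ)) : ZMod p), C_mul, Nat.add_sub_cancel, pow_succ X j]; ring
      rw [← hl, h]
      have : p - 1 - s = (p - 1 - (s + 1)) + 1 := by omega
      rw [this, Nat.add_sub_cancel, pow_succ]; ring
    · simp only [eval_mul, eval_add, eval_X, eval_C, eval_sub, eval_one, sub_self, zero_mul, add_zero, hk1]
      have : ((p - 1 - s : ℕ) : ZMod p) = - (s + 1 : ℕ) := by
        rw [eq_neg_iff_add_eq_zero, ← Nat.cast_add, ZMod.natCast_eq_zero_iff]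
        exact ⟨1, by omega⟩
      rw [this, Nat.factorial_succ, Nat.cast_mul, pow_succ]; ring

theorem root_factor (h : (ZMod p)[X]) (h0 : h.eval 1 = 0) :
    ∃ k : (ZMod p)[X], h = (X - 1) * k ∧ k.eval 1 = (derivative h).eval 1 := by
  obtain ⟨k, hk⟩ := dvd_iff_isRoot.mpr h0
  rw [C_1] at hk
  refine ⟨k, hk, ?_⟩
  rw [hk]; simp

/-- the sine product -/
noncomputable def WW (p n : ℕ) [Fact p.Prime] : ℂ :=
  ∏ i : Fin n, (ZMod.stdAddChar (rr p i) - (ZMod.stdAddChar (rr p i))⁻¹)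

theorem WW_sq {n : ℕ} (hpn : p = 2 * n + 1) (hn : Even n) (hp4 : p % 4 = 1) : WW p n ^ 2 = p := by
  rw [← prod_one_sub_psi hpn 2 (two_ne hp4), pair_prod hpn, WW, ← Finset.prod_pow]
  have : ∏ i : Fin n, (ZMod.stdAddChar (rr p i) - (ZMod.stdAddChar (rr p i))⁻¹) ^ 2
    = ∏ i : Fin n, ((-1) * (ZMod.stdAddChar (rr p i) - (ZMod.stdAddChar (rr p i))⁻¹) ^ 2) := by
    rw [Finset.prod_mul_distrib]; simp [hn.neg_one_pow]
  rw [this]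
  refine Finset.prod_congr rfl fun i _ => ?_
  rw [mul_neg, AddChar.map_neg_eq_inv, two_mul, AddChar.map_add_eq_mul]
  have := psi_ne (rr p i)
  field_simp; ring

theorem WW_eq {n m : ℕ} (hpn : p = 2 * n + 1) (hnm : n = 2 * m) (hp4 : p % 4 = 1) :
    WW p n = (-1) ^ m * ((Real.sqrt p : ℝ) : ℂ) := by
  have hp0 : (0 : ℝ) < p := by exact_mod_cast hpf.out.pos
  set s : ℝ := ∏ i : Fin n, (2 * Real.sin (2 * Real.pi * ((i : ℕ) + 1 : ℕ) / p)) with hs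
  have h1 : WW p n = (-1) ^ m * (s : ℂ) := by
    have hI : (-1 : ℂ) ^ m = ∏ i : Fin n, Complex.I := by
      rw [Finset.prod_const, Finset.card_univ, Fintype.card_fin, hnm, pow_mul, Complex.I_sq]
    rw [hI, hs, Complex.ofReal_prod, ← Finset.prod_mul_distrib, WW]
    refine Finset.prod_congr rfl fun i _ => ?_
    have h1 : ZMod.stdAddChar (rr p i) = Complex.exp ((2 * Real.pi * ((i : ℕ) + 1 : ℕ) / p : ℝ) * Complex.I) := by
      rw [rr, psi_exp]; congr 1; push_cast; ring
    rw [h1, ← Complex.exp_neg, Complex.ofReal_mul, Complex.ofReal_sin, Complex.sin]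
    push_cast
    ring_nf
    simp only [Complex.I_sq]; ring
  have hpos : 0 < s := by
    apply Finset.prod_pos
    intro i _
    have := i.2
    apply mul_pos two_pos
    apply Real.sin_pos_of_pos_of_lt_pi
    · have := Real.pi_pos; positivity
    · rw [div_lt_iff₀ hp0]
      have : (2 * (((i : ℕ) + 1 : ℕ) : ℝ)) < p := by exact_mod_cast (by omega)
      nlinarith [Real.pi_pos]
  have hsq : s ^ 2 = p := by
    have h := WW_sq hpn ⟨m, by omega⟩ hp4
    rw [h1, mul_pow, ← pow_mul, mul_comm m 2, pow_mul] at h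
    norm_num at h
    exact_mod_cast h
  rw [h1, ← hsq, Real.sqrt_sq hpos.le]

theorem gs_range : gs p = ∑ j ∈ range p, ((quadraticChar (ZMod p) (j : ZMod p) : ℤ) : ℂ) * (ZMod.stdAddChar (1 : ZMod p)) ^ j := by
  rw [gs]
  refine Finset.sum_bij' (fun r _ => r.val) (fun k _ => (k : ZMod p)) ?_ ?_ ?_ ?_ ?_
  · intro r _; exact Finset.mem_range.mpr (ZMod.val_lt r)
  · intros; exact mem_univ _
  · intro r _; simp
  · intro k hk; exact ZMod.val_natCast_of_lt (Finset.mem_range.mp hk)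
  · intro r _
    rw [qc, ← AddChar.map_nsmul_eq_pow]; simp

theorem gs_eq {n m : ℕ} (hpn : p = 2 * n + 1) (hnm : n = 2 * m) (hp4 : p % 4 = 1) :
    gs p = ((Real.sqrt p : ℝ) : ℂ) := by
  have hp := hpf.out
  obtain ⟨ε, hε, hg⟩ : ∃ ε : ℤ, (ε = 1 ∨ ε = -1) ∧ gs p = ε * WW p n := by
    have h : gs p ^ 2 = WW p n ^ 2 := by rw [gs_sq hp4, WW_sq hpn ⟨m, by omega⟩ hp4]
    rcases sq_eq_sq_iff_eq_or_eq_neg.mp h with h | h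
    · exact ⟨1, Or.inl rfl, by simpa using h⟩
    · exact ⟨-1, Or.inr rfl, by simpa using h⟩
  set ω := ZMod.stdAddChar (1 : ZMod p) with hω
  have hprim : IsPrimitiveRoot ω p := by
    have := Complex.isPrimitiveRoot_exp p hp.ne_zero
    convert this using 1
    have := ZMod.stdAddChar_coe (N := p) 1
    simpa using this
  have hωk : ∀ k : ℕ, ω ^ k = ZMod.stdAddChar (k : ZMod p) := by
    intro k; rw [hω, ← AddChar.map_nsmul_eq_pow]; simp
  set f : ℤ[X] := ∑ j ∈ range p, C (quadraticChar (ZMod p) (j : ZMod p)) * X ^ j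
    - C ε * ∏ i : Fin n, (X ^ ((i : ℕ) + 1) - X ^ (p - ((i : ℕ) + 1))) with hf
  have hf0 : aeval ω f = 0 := by
    rw [hf]
    simp only [map_sub, map_sum, map_mul, map_prod, map_pow, aeval_X, aeval_C]
    simp only [algebraMap_int_eq, eq_intCast]
    rw [← gs_range, hg, WW, sub_eq_zero]
    congr 1
    refine Finset.prod_congr rfl fun i _ => ?_
    rw [hωk, hωk, ← AddChar.map_neg_eq_inv, rr]
    congr 2
    have := i.2
    rw [eq_comm, eq_neg_iff_add_eq_zero, ← Nat.cast_add, ZMod.natCast_eq_zero_iff]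
    exact ⟨1, by omega⟩
  have hdvd : cyclotomic p ℤ ∣ f := by
    rw [cyclotomic_eq_minpoly hprim hp.pos]
    exact minpoly.isIntegrallyClosed_dvd (hprim.isIntegral hp.pos) hf0
  have hdvd2 : ((X - 1) ^ (p - 1) : (ZMod p)[X]) ∣ f.map (Int.castRingHom (ZMod p)) := by
    have h := Polynomial.map_dvd (Int.castRingHom (ZMod p)) hdvd
    rw [map_cyclotomic] at h
    have h2 := cyclotomic_mul_prime_eq_pow_of_not_dvd (ZMod p) (p := p) (n := 1)
      (fun h => hp.one_lt.ne' (Nat.dvd_one.mp h))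
    rw [one_mul, cyclotomic_one] at h2
    rwa [h2] at h
  obtain ⟨k, hk, hk1⟩ := theta_pow (p := p) n (by omega)
  have hki : ∀ i : Fin n, ∃ k : (ZMod p)[X], (X ^ ((i : ℕ) + 1) - X ^ (p - ((i : ℕ) + 1)) : (ZMod p)[X]) = (X - 1) * k
      ∧ k.eval 1 = 2 * rr p i := by
    intro i
    obtain ⟨k, h1, h2⟩ := root_factor (p := p) (X ^ ((i : ℕ) + 1) - X ^ (p - ((i : ℕ) + 1))) (by simp)
    refine ⟨k, h1, h2.trans ?_⟩
    have := i.2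
    have e : ((p - ((i : ℕ) + 1) : ℕ) : ZMod p) = - rr p i := by
      rw [rr, eq_neg_iff_add_eq_zero, ← Nat.cast_add, ZMod.natCast_eq_zero_iff]
      exact ⟨1, by omega⟩
    simp only [derivative_sub, derivative_X_pow, eval_sub, eval_mul, eval_C, eval_pow, eval_X, one_pow, mul_one]
    rw [e, rr]; ring
  choose kk hkk hkk1 using hki
  have hfm : f.map (Int.castRingHom (ZMod p)) = (X - 1) ^ n * (k - C (ε : ZMod p) * ∏ i, kk i) := by
    rw [hf]
    simp only [Polynomial.map_sub, Polynomial.map_mul, Polynomial.map_sum, Polynomial.map_prod, Polynomial.map_pow, map_X, Polynomial.map_C]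
    simp only [eq_intCast (Int.castRingHom (ZMod p))]
    have e1 : ∑ j ∈ range p, C (((quadraticChar (ZMod p) (j : ZMod p) : ℤ) : ZMod p)) * X ^ j
      = ∑ j ∈ range p, C ((j : ZMod p) ^ n) * X ^ j := by
      refine Finset.sum_congr rfl fun j _ => ?_
      rw [quadraticChar_eq_pow_of_char_ne_two' (ringChar_ne hp4), ZMod.card, show p / 2 = n by omega]
    rw [e1, hk, show p - 1 - n = n by omega, Finset.prod_congr rfl (fun i _ => hkk i), Finset.prod_mul_distrib]
    simp only [Finset.prod_const, Finset.card_univ, Fintype.card_fin]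
    ring
  have h3 : (X - 1 : (ZMod p)[X]) ≠ 0 := by
    have := X_sub_C_ne_zero (1 : ZMod p); simpa using this
  have hn0 : n ≠ 0 := by rintro rfl; rw [hpn] at hp; exact Nat.not_prime_one hp
  have hdvd3 : (X - 1 : (ZMod p)[X]) ∣ (k - C (ε : ZMod p) * ∏ i, kk i) := by
    rw [hfm, show p - 1 = n + n by omega, pow_add] at hdvd2
    exact (dvd_pow_self _ hn0).trans ((mul_dvd_mul_iff_left (pow_ne_zero n h3)).mp hdvd2)
  obtain ⟨q, hq⟩ := hdvd3
  have hev := congrArg (eval 1) hq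
  simp only [eval_sub, eval_mul, eval_C, eval_prod, hk1, hkk1, eval_X, eval_one, sub_self, zero_mul,
    Finset.prod_mul_distrib, Finset.prod_const, Finset.card_univ, Fintype.card_fin, rr_fact] at hev
  have hs := fact_sq hpn ⟨m, by omega⟩
  have hne : ((n.factorial : ℕ) : ZMod p) ≠ 0 := by
    intro h; rw [h] at hs; simp at hs
  have h2n : (2 : ZMod p) ^ n = (-1) ^ m := by
    have h := quadraticChar_eq_pow_of_char_ne_two' (F := ZMod p) (ringChar_ne hp4) 2
    rw [qchar_two hpn hnm hp4, ZMod.card, show p / 2 = n by omega] at h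
    rw [← h]; simp
  have hne1 : (-1 : ZMod p) ^ n = 1 := by rw [hnm, pow_mul]; simp
  rw [h2n, hne1] at hev
  have hmm : ((-1 : ZMod p) ^ m) * (-1) ^ m = 1 := by rw [← mul_pow]; simp
  have hfin : ((ε : ℤ) : ZMod p) = (((-1) ^ m : ℤ) : ZMod p) := by
    apply mul_right_cancel₀ hne
    push_cast
    linear_combination (-(-1) ^ m) * hev - (ε * ((n.factorial : ℕ) : ZMod p)) * hmm
  have hε2 := pm_eq hp4 hε (neg_one_pow_eq_or ℤ m) hfin
  rw [hg, hε2, WW_eq hpn hnm hp4]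
  push_cast
  rw [← mul_assoc, ← mul_pow]; simp
end

section
variable {p : ℕ} [hpf : Fact p.Prime]

theorem core {n m : ℕ} (hpn : p = 2 * n + 1) (hnm : n = 2 * m) (hp4 : p % 4 = 1) (A B : ℂ)
    (h1 : (∏ i : Fin n, (1 + tt (rr p i))) ^ 2
      = (∏ i : Fin n, tt (rr p i)) * (B * p + A * ((Real.sqrt p : ℝ) : ℂ)))
    (h2 : (∏ i : Fin n, (1 - tt (rr p i))) ^ 2
      = (∏ i : Fin n, tt (rr p i)) * (B * p - A * ((Real.sqrt p : ℝ) : ℂ))) :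
    (Matrix.of fun j k : Fin n => qc (p := p) (((j : ℤ) - k + 1 : ℤ) : ZMod p)
        - qc (p := p) ((k : ℤ) : ZMod p)).det = qc (2 : ZMod p)
    ∧ ∀ ξ : ℂ, (Matrix.of fun j k : Fin n => qc (p := p) (((j : ℤ) - k + 1 : ℤ) : ZMod p) + ξ).det
      = qc (2 : ZMod p) * (B - A) + ξ * (p * B - A) := by
  have hp := hpf.out
  have hn : Even n := ⟨m, by omega⟩
  have hn0 : 0 < n := by
    rcases Nat.eq_zero_or_pos n with h | h
    · subst h; rw [hpn] at hp; exact absurd hp Nat.not_prime_one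
    · exact h
  have hpC : (p : ℂ) ≠ 0 := by exact_mod_cast hp.ne_zero
  set t : Fin n → ℂ := fun i => tt (rr p i) with ht
  set e : Fin n → ℂ := fun i => qc (rr p i) with hedef
  set s : ℂ := ((Real.sqrt p : ℝ) : ℂ) with hs
  have hgs : gs p = s := gs_eq hpn hnm hp4
  have hs2 : s ^ 2 = p := by rw [← hgs]; exact gs_sq hp4
  have hs0 : s ≠ 0 := by
    intro h; rw [h] at hs2; apply hpC; rw [← hs2]; simp
  have h20 : (2 : ZMod p) ≠ 0 := two_ne hp4
  have hc : (-2 : ZMod p) ≠ 0 := neg_ne_zero.mpr h20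
  have hr0 := fun i => rr_ne (p := p) hpn (n := n) i
  have h0 : ∀ i, t i ≠ 0 := fun i => tt_ne (hr0 i)
  have he : ∀ i, e i ^ 2 = 1 := fun i => qc_sq (hr0 i)
  have htsq : ∀ i, t i ^ 2 = ZMod.stdAddChar (-2 * rr p i) := by
    intro i
    simp only [ht, tt]
    rw [mul_pow, qc_sq (hr0 i), one_mul, ← AddChar.map_nsmul_eq_pow]
    congr 1; simp
  have hx : Function.Injective (fun i => t i ^ 2) := by
    intro i j h
    simp only [htsq] at h
    exact rr_inj hpn (mul_left_cancel₀ hc (psi_inj h))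
  have hxx : ∀ i l, 1 - t i ^ 2 * t l ^ 2 ≠ 0 := by
    intro i l h
    rw [htsq, htsq, ← AddChar.map_add_eq_mul, sub_eq_zero, ← AddChar.map_zero_eq_one (ZMod.stdAddChar (N := p))] at h
    have h' := psi_inj h
    apply rr_add_ne hpn i l
    rw [← mul_add, eq_comm, mul_eq_zero] at h'
    exact eq_neg_of_add_eq_zero_left (h'.resolve_left hc)
  have h2' : ∀ i, t i ^ 2 - 1 ≠ 0 := by
    intro i h
    rw [htsq, sub_eq_zero, ← AddChar.map_zero_eq_one (ZMod.stdAddChar (N := p))] at h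
    have h' := psi_inj h
    exact hr0 i ((mul_eq_zero.mp h').resolve_left hc)
  have hL : qc (2 : ZMod p) ^ 2 = 1 := qc_sq h20
  have zf := zfacts hpn (fun i : Fin n => t i ^ 2) (fun i => by simp only [htsq]; exact psi_pow _) (by
    simp only [htsq]; exact psi_poly' hpn (-2) hc)
  have hen : ∀ i, (t i ^ 2) ^ (n + 1) = e i * t i := by
    intro i
    have h3 : e i * t i = ZMod.stdAddChar (-rr p i) := by
      simp only [ht, hedef, tt]
      rw [← mul_assoc, ← sq, qc_sq (hr0 i), one_mul]
    rw [h3, htsq, ← AddChar.map_nsmul_eq_pow]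
    congr 1
    have hpz : ((2 * n + 1 : ℕ) : ZMod p) = 0 := by rw [← hpn]; simp
    push_cast at hpz
    rw [nsmul_eq_mul]; push_cast
    linear_combination (-rr p i) * hpz
  have hK := hK_aux (p := p) hn t e h0 hx h2' hen he zf.2.2
  have hκ := hκ_aux (p := p) hn t h0 zf.1
  have hχ : ∀ k : ℤ, s * qc (p := p) (k : ZMod p)
      = qc (2 : ZMod p) * ∑ i, e i * ((t i ^ 2) ^ k + (t i ^ 2) ^ (-k)) := by
    intro k
    have h := half_sum hpn hp4 (-(2 * (k : ZMod p)))
    rw [qc_neg hp4, qc_mul, hgs] at h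
    have h3 : ∑ i, e i * ((t i ^ 2) ^ k + (t i ^ 2) ^ (-k)) = qc (2 : ZMod p) * qc (k : ZMod p) * s := by
      rw [h]
      refine Finset.sum_congr rfl fun i _ => ?_
      rw [htsq, _root_.zpow_neg, ← AddChar.map_zsmul_eq_zpow]
      have : k • (-2 * rr p i) = -(2 * (k : ZMod p)) * rr p i := by
        rw [zsmul_eq_mul]; ring
      rw [this]
    rw [h3]; linear_combination (-s * qc (k : ZMod p)) * hL
  have hg : s = ∑ i, (t i + (t i)⁻¹) := by
    have h := half_sum hpn hp4 (-1)
    rw [qc_neg_one hp4, one_mul, hgs] at h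
    rw [h]
    refine Finset.sum_congr rfl fun i _ => ?_
    simp only [ht]
    rw [← tt_neg hp4 (hr0 i), tt, tt, qc_neg hp4, neg_neg, neg_one_mul, ← AddChar.map_neg_eq_inv, neg_neg]; ring
  set τ := ∏ i, t i with hτ
  have hτ0 : τ ≠ 0 := Finset.prod_ne_zero_iff.mpr fun i _ => h0 i
  have hA := detA' hn t e (p * τ ^ 2) (qc (2 : ZMod p)) s τ p (fun k => qc (p := p) (k : ZMod p)) h0 hx hxx h2' he hL hK hχ hτ rfl hn0
  have hXX : ∏ i, ∏ l ∈ univ.erase i, ((t i + (t i)⁻¹) + (t l + (t l)⁻¹)) = (p : ℂ) ^ m := X_eq hpn hnm hp4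
  have hqq : ∏ i, (t i + (t i)⁻¹) = 1 := prod_q hpn hnm hp4
  have hLm : qc (2 : ZMod p) = (-1) ^ m := by
    rw [qc, qchar_two hpn hnm hp4]; push_cast; rfl
  have hM0 : (Matrix.of fun j k : Fin n => qc (p := p) (((j : ℤ) - k + 1 : ℤ) : ZMod p)
        - qc (p := p) ((k : ℤ) : ZMod p)).det = qc (2 : ZMod p) := by
    rw [hXX, hqq, mul_one, show n / 2 = m by omega, ← hLm] at hA
    have e1 : s ^ n = (p : ℂ) ^ m := by rw [hnm, pow_mul, hs2]
    have e2 : (p : ℂ) ^ n = (p : ℂ) ^ m * (p : ℂ) ^ m := by rw [← pow_add]; congr 1; omega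
    rw [e1, e2] at hA
    have hpm : (p : ℂ) ^ m * (p : ℂ) ^ m ≠ 0 := mul_ne_zero (pow_ne_zero _ hpC) (pow_ne_zero _ hpC)
    apply mul_right_cancel₀ hpm
    rw [← hA]; ring
  refine ⟨hM0, fun ξ => ?_⟩
  have hB := detB' hn t e (p * τ ^ 2) (qc (2 : ZMod p)) s ξ τ (fun k => qc (p := p) (k : ZMod p)) h0 hx hxx h2' he hL hK hκ hχ hs0 hg hτ
  rw [hM0] at hB
  have h1' : (∏ i, (1 + t i)) ^ 2 = τ * (B * p + A * s) := h1
  have h2'' : (∏ i, (1 - t i)) ^ 2 = τ * (B * p - A * s) := h2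
  rw [h1', h2''] at hB
  have hne : 2 * (p * τ ^ 2) ≠ 0 := mul_ne_zero two_ne_zero (mul_ne_zero hpC (pow_ne_zero _ hτ0))
  apply mul_left_cancel₀ hne
  rw [hB]
  have hs3 : s ^ 3 = p * s := by rw [pow_succ, hs2]
  linear_combination (2 * qc (2 : ZMod p) * τ ^ 2 * (B * p * ξ * qc (2 : ZMod p) - A - A * ξ * qc (2 : ZMod p))) * hs2 + (2 * p * τ ^ 2 * ξ * (p * B - A)) * hL
end

theorem fin_alg {n : ℕ} (M : Matrix (Fin n) (Fin n) ℂ) (c v : Fin n → ℂ) (D P L : ℂ)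
    (hD : D ≠ 0) (hMv : M *ᵥ v = c) (hcv : c ⬝ᵥ v = 1) (h1v : (fun _ => 1) ⬝ᵥ v = 1)
    (hξ : ∀ ξ : ℂ, (Matrix.of fun j k => M j k + ξ).det = D + ξ * P)
    (hm : (Matrix.of fun j k => M j k - c k).det = L) (x y z w : ℂ) :
    (Matrix.of fun j k => x + M j k + c j * y + c k * z + c j * c k * w).det
      = P * ((w + 1) * x - y * z) + L * (w * x - (y + 1) * z)
        + D * (w * (1 - x) + (y + 1) * (z + 1)) := by
  have hMD : M.det = D := by
    have h := hξ 0
    simp only [add_zero, zero_mul] at h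
    exact h
  have hu : IsUnit M.det := by rw [hMD]; exact hD.isUnit
  set u : Fin n → ℂ := M⁻¹ *ᵥ (fun _ => 1) with hudef
  have hMu : M *ᵥ u = fun _ => 1 := by
    rw [hudef, mulVec_mulVec, mul_nonsing_inv _ hu, one_mulVec]
  have gen : ∀ a : Fin n → ℂ, (Matrix.of fun j k => M j k + a k).det = D * (1 + a ⬝ᵥ u) := by
    intro a
    have : (Matrix.of fun j k => M j k + a k) = M * (1 + vecMulVec u a) := by
      rw [Matrix.mul_add, mul_one, mul_vecMulVec, hMu]
      ext j k; simp [vecMulVec_apply]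
    rw [this, det_mul, hMD, vecMulVec_eq Unit, det_one_add_replicateCol_mul_replicateRow]
  have hE : D * ((fun _ => 1) ⬝ᵥ u) = P := by
    have h := gen (fun _ => 1)
    rw [hξ 1] at h
    linear_combination -h
  have hF : D * (c ⬝ᵥ u) = D - L := by
    have h := gen (-c)
    have e : (Matrix.of fun j k => M j k + (-c) k) = (Matrix.of fun j k => M j k - c k) := by
      ext j k; simp [sub_eq_add_neg]
    rw [e, hm, neg_dotProduct] at h
    linear_combination h
  set α : Fin n → ℂ := fun k => y + w * c k with hα
  set β : Fin n → ℂ := fun k => x + z * c k with hβ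
  set U : Matrix (Fin n) (Fin 2) ℂ := Matrix.of fun j a => (![v j, u j] : Fin 2 → ℂ) a with hU
  set V : Matrix (Fin 2) (Fin n) ℂ := Matrix.of ![α, β] with hV
  have hfac : (Matrix.of fun j k => x + M j k + c j * y + c k * z + c j * c k * w) = M * (1 + U * V) := by
    have hUV : U * V = vecMulVec v α + vecMulVec u β := by
      ext j k; simp [hU, hV, Matrix.mul_apply, Fin.sum_univ_two, vecMulVec_apply]
    rw [hUV, Matrix.mul_add, Matrix.mul_add, mul_one, mul_vecMulVec, mul_vecMulVec, hMu, hMv]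
    ext j k
    simp [vecMulVec_apply, hα, hβ]; ring
  have hdot : ∀ (a b : ℂ) (q : Fin n → ℂ), (fun k => a + b * c k) ⬝ᵥ q = a * ((fun _ => 1) ⬝ᵥ q) + b * (c ⬝ᵥ q) := by
    intro a b q
    simp only [dotProduct, Finset.mul_sum, ← Finset.sum_add_distrib]
    exact Finset.sum_congr rfl fun i _ => by ring
  have hVU : V * U = !![α ⬝ᵥ v, α ⬝ᵥ u; β ⬝ᵥ v, β ⬝ᵥ u] := by
    ext a b
    fin_cases a <;> fin_cases b <;> simp [hU, hV, Matrix.mul_apply, dotProduct]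
  rw [hfac, det_mul, det_one_add_mul_comm, hVU, hMD, det_fin_two]
  simp only [Matrix.add_apply, Matrix.one_apply_eq, Matrix.of_apply, Matrix.cons_val', Matrix.cons_val_zero,
    Matrix.cons_val_one, ne_eq, zero_ne_one, one_ne_zero, not_false_eq_true, Matrix.one_apply_ne, zero_add,
    Matrix.cons_val_fin_one]
  rw [hα, hβ, hdot, hdot, hdot, hdot, hcv, h1v]
  linear_combination ((1 + w) * x - y * z) * hE + (z * (1 + y) - w * x) * hF

theorem Icc_prod {n : ℕ} (f : ℕ → ℂ) : ∏ r ∈ Finset.Icc 1 n, f r = ∏ i : Fin n, f ((i : ℕ) + 1) := by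
  rw [← Finset.prod_range (fun i => f (i + 1))]
  induction n with
  | zero => simp
  | succ n ih => rw [Finset.prod_Icc_succ_top (by omega), ih, Finset.prod_range_succ]

theorem zpow_tri (ζ : ℂ) (hz : ζ ≠ 0) (n : ℕ) :
    ∏ i ∈ range n, ζ ^ (-((i + 1 : ℕ) : ℤ)) = ζ ^ (-((n * (n + 1) / 2 : ℕ) : ℤ)) := by
  induction n with
  | zero => simp
  | succ n ih =>
    rw [Finset.prod_range_succ, ih, ← zpow_add₀ hz]
    congr 1
    have : (n + 1) * (n + 1 + 1) / 2 = n * (n + 1) / 2 + (n + 1) := by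
      rw [show (n + 1) * (n + 1 + 1) = n * (n + 1) + (n + 1) * 2 by ring, Nat.add_mul_div_right _ _ two_pos]
    rw [this]; push_cast; ring

/-- Sun's Conjecture 4.8(i): the four-parameter Legendre-symbol determinant. -/
theorem stmt_0 (p : ℕ) [Fact p.Prime] (hp3 : 3 < p) (hp4 : p % 4 = 1)
    (n : ℕ) (hn : n = (p - 1) / 2)
    (ζ : ℂ) (hζ : ζ = Complex.exp (2 * Real.pi * Complex.I / p))
    (A B : ℝ) (hBA : B ≠ A)
    (hAB1 : ∏ r ∈ Finset.Icc 1 n, (1 + (legendreSym p (r : ℤ) : ℂ) * ζ ^ (-(r : ℤ))) ^ 2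
        = (-1 : ℂ) ^ (n / 2) * ζ ^ (-((n * (n + 1) / 2 : ℕ) : ℤ))
          * ((B : ℂ) * (p : ℂ) + (A : ℂ) * ((Real.sqrt p : ℝ) : ℂ)))
    (hAB2 : ∏ r ∈ Finset.Icc 1 n, (1 - (legendreSym p (r : ℤ) : ℂ) * ζ ^ (-(r : ℤ))) ^ 2
        = (-1 : ℂ) ^ (n / 2) * ζ ^ (-((n * (n + 1) / 2 : ℕ) : ℤ))
          * ((B : ℂ) * (p : ℂ) - (A : ℂ) * ((Real.sqrt p : ℝ) : ℂ)))
    (L Q P : ℝ) (hL : L = (legendreSym p 2 : ℝ)) (hQ : Q = B - A) (hP : P = p * B - A)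
    (x y z w : ℝ) :
    (Matrix.of fun j k : Fin n =>
        x + (legendreSym p (((j : ℕ) : ℤ) - ((k : ℕ) : ℤ) + 1) : ℝ)
          + (legendreSym p ((j : ℕ) : ℤ) : ℝ) * y
          + (legendreSym p ((k : ℕ) : ℤ) : ℝ) * z
          + (legendreSym p (((j : ℕ) : ℤ) * ((k : ℕ) : ℤ)) : ℝ) * w).det
      = P * ((w + 1) * x - y * z) + L * (w * x - (y + 1) * z)
        + L * Q * (w * (1 - x) + (y + 1) * (z + 1)) := by
  obtain ⟨m, hnm⟩ : ∃ m, n = 2 * m := ⟨(p - 1) / 4, by omega⟩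
  have hpn : p = 2 * n + 1 := by omega
  have hn2 : 1 < n := by omega
  have hζ1 : ζ = ZMod.stdAddChar (1 : ZMod p) := by
    have := psi_exp (p := p) 1
    rw [Nat.cast_one] at this
    rw [this, hζ]; simp
  have hz0 : ζ ≠ 0 := by rw [hζ1]; exact psi_ne 1
  have hzr : ∀ i : Fin n, ζ ^ (-(((i : ℕ) + 1 : ℕ) : ℤ)) = ZMod.stdAddChar (-(rr p i)) := by
    intro i
    rw [hζ1, ← AddChar.map_zsmul_eq_zpow, rr]
    congr 1; simp
  have htt : ∀ i : Fin n, ((legendreSym p (((i : ℕ) + 1 : ℕ) : ℤ) : ℤ) : ℂ) * ζ ^ (-(((i : ℕ) + 1 : ℕ) : ℤ))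
      = tt (rr p i) := by
    intro i
    rw [hzr, tt, qc_leg, rr]; simp
  have hτ : (-1 : ℂ) ^ (n / 2) * ζ ^ (-((n * (n + 1) / 2 : ℕ) : ℤ)) = ∏ i : Fin n, tt (rr p i) := by
    rw [← zpow_tri ζ hz0, Finset.prod_range]
    have h := prod_qc hpn hnm hp4
    have h' : ∏ i : Fin n, qc (rr p i) = (-1) ^ m := by
      simp only [qc]; exact_mod_cast congrArg (fun a : ℤ => (a : ℂ)) h
    rw [show n / 2 = m by omega, ← h', ← Finset.prod_mul_distrib]
    refine Finset.prod_congr rfl fun i _ => ?_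
    rw [hzr, tt]
  rw [hτ, Icc_prod, Finset.prod_pow] at hAB1 hAB2
  simp only [htt] at hAB1 hAB2
  obtain ⟨c1, c2⟩ := core hpn hnm hp4 (A : ℂ) (B : ℂ) hAB1 hAB2
  have hLC : ((L : ℝ) : ℂ) = qc (2 : ZMod p) := by
    rw [hL]
    have := qc_leg (p := p) 2
    push_cast at this ⊢
    exact this
  have hD0 : qc (2 : ZMod p) * ((B : ℂ) - A) ≠ 0 := by
    refine mul_ne_zero (qc_ne (two_ne hp4)) (sub_ne_zero.mpr ?_)
    exact_mod_cast hBA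
  have hfin := fin_alg (Matrix.of fun j k : Fin n => qc (p := p) (((j : ℤ) - k + 1 : ℤ) : ZMod p))
    (fun k => qc (p := p) ((k : ℤ) : ZMod p)) (Pi.single ⟨1, hn2⟩ 1) _ (p * B - A) (qc (2 : ZMod p)) hD0
    (by ext j; simp) (by simp [qc]) (by simp) (fun ξ => c2 ξ) c1 x y z w
  apply Complex.ofReal_injective
  have hmap : (((Matrix.of fun j k : Fin n =>
        x + (legendreSym p (((j : ℕ) : ℤ) - ((k : ℕ) : ℤ) + 1) : ℝ)
          + (legendreSym p ((j : ℕ) : ℤ) : ℝ) * y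
          + (legendreSym p ((k : ℕ) : ℤ) : ℝ) * z
          + (legendreSym p (((j : ℕ) : ℤ) * ((k : ℕ) : ℤ)) : ℝ) * w).det : ℝ) : ℂ)
      = (Matrix.of fun j k : Fin n => (x : ℂ) + qc (p := p) (((j : ℤ) - k + 1 : ℤ) : ZMod p)
        + qc (p := p) ((j : ℤ) : ZMod p) * y + qc (p := p) ((k : ℤ) : ZMod p) * z
        + qc (p := p) ((j : ℤ) : ZMod p) * qc (p := p) ((k : ℤ) : ZMod p) * w).det := by
    have := RingHom.map_det Complex.ofRealHom (Matrix.of fun j k : Fin n =>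
        x + (legendreSym p (((j : ℕ) : ℤ) - ((k : ℕ) : ℤ) + 1) : ℝ)
          + (legendreSym p ((j : ℕ) : ℤ) : ℝ) * y
          + (legendreSym p ((k : ℕ) : ℤ) : ℝ) * z
          + (legendreSym p (((j : ℕ) : ℤ) * ((k : ℕ) : ℤ)) : ℝ) * w)
    rw [Complex.ofRealHom_eq_coe] at this
    rw [this]
    congr 1
    ext j k
    simp only [RingHom.mapMatrix_apply, Matrix.map_apply, Matrix.of_apply, Complex.ofRealHom_eq_coe]
    simp only [Complex.ofReal_add, Complex.ofReal_mul, Complex.ofReal_intCast, qc_leg]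
    rw [← qc_mul, Int.cast_mul]
  rw [hmap]
  refine hfin.trans ?_
  rw [hP, hQ]
  push_cast
  rw [hLC]
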